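/- arXiv:1511.04937 — 3 statements merged into one kernel-verified Lean document; each statement's English description precedes it below -/
import Mathlib

section
/- Let b ≥ 2 and let σ be a permutation of {0,…,b−1} with σ∘τ = τ∘σ, where τ(k) = b−1−k. Then Φ̃_b^σ − (1/2)Φ̃_{b,1}^σ − (1/2)Φ̃_{b,2}^σ = −1/24 if b is even, and Φ̃_b^σ − (1/2)Φ̃_{b,1}^σ − (1/2)Φ̃_{b,2}^σ = −(b^2−1)/(24·b^2) if b is odd. -/
open Finset
open scoped Classical

noncomputable section

namespace SymHamm

/-- The reversal permutation `τ(k) = b−1−k` on `{0,…,b−1}`. -/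
def tauP (b : ℕ) : Equiv.Perm (Fin b) := Fin.revPerm

/-- `σ̄ = τ ∘ σ`. -/
def pbar {b : ℕ} (σ : Equiv.Perm (Fin b)) : Equiv.Perm (Fin b) := σ.trans (tauP b)

/-- Value of a permutation of `Fin b` on a natural number. -/
def permVal {b : ℕ} (σ : Equiv.Perm (Fin b)) (k : ℕ) : ℕ :=
  if h : k < b then (σ ⟨k, h⟩ : ℕ) else 0

/-- Faure's function `φ_{b,h}^σ`, extended with period 1 to all of `ℝ`.
For `x ∈ [(k−1)/b, k/b)` (i.e. `k−1 = ⌊b·{x}⌋`), it equals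
`A([0,h/b);k;Z_b^σ) − h·x` if `h ≤ σ(k−1)` and `(b−h)·x − A([h/b,1);k;Z_b^σ)` otherwise,
where `A` counts the first `k` entries `σ(0)/b,…,σ(k−1)/b` of `Z_b^σ` in the interval. -/
def phi {b : ℕ} (σ : Equiv.Perm (Fin b)) (h : ℕ) (x : ℝ) : ℝ :=
  if h ≤ permVal σ (⌊(b : ℝ) * Int.fract x⌋).toNat then
    (((Finset.range ((⌊(b : ℝ) * Int.fract x⌋).toNat + 1)).filter
        (fun l => permVal σ l < h)).card : ℝ) - (h : ℝ) * Int.fract x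
  else
    ((b : ℝ) - (h : ℝ)) * Int.fract x -
      (((Finset.range ((⌊(b : ℝ) * Int.fract x⌋).toNat + 1)).filter
        (fun l => h ≤ permVal σ l)).card : ℝ)

/-- `φ_b^σ = ∑_{h=0}^{b−1} φ_{b,h}^σ`. -/
def phiS {b : ℕ} (σ : Equiv.Perm (Fin b)) (x : ℝ) : ℝ := ∑ h ∈ range b, phi σ h x

/-- `φ_b^{σ,(2)} = ∑_{h=0}^{b−1} (φ_{b,h}^σ)²`. -/
def phiS2 {b : ℕ} (σ : Equiv.Perm (Fin b)) (x : ℝ) : ℝ := ∑ h ∈ range b, (phi σ h x) ^ 2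

/-- `φ̃_b^σ = ∑_{h=0}^{b−1} φ_{b,h}^σ · φ_{b,h}^{σ̄}`. -/
def phiT {b : ℕ} (σ : Equiv.Perm (Fin b)) (x : ℝ) : ℝ :=
  ∑ h ∈ range b, phi σ h x * phi (pbar σ) h x

/-- `φ̃_{b,1}^σ = ∑_{h=0}^{b−2} φ_{b,h+1}^σ · φ_{b,h}^{σ̄}`. -/
def phiT1 {b : ℕ} (σ : Equiv.Perm (Fin b)) (x : ℝ) : ℝ :=
  ∑ h ∈ range (b - 1), phi σ (h + 1) x * phi (pbar σ) h x

/-- `φ̃_{b,2}^σ = ∑_{h=0}^{b−2} φ_{b,h}^σ · φ_{b,h+1}^{σ̄}`. -/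
def phiT2 {b : ℕ} (σ : Equiv.Perm (Fin b)) (x : ℝ) : ℝ :=
  ∑ h ∈ range (b - 1), phi σ h x * phi (pbar σ) (h + 1) x

/-- `Φ_b^σ = (1/b)·∫_0^1 φ_b^σ`. -/
def PhiS {b : ℕ} (σ : Equiv.Perm (Fin b)) : ℝ := (1 / (b : ℝ)) * ∫ x in (0:ℝ)..1, phiS σ x

/-- `Φ_b^{σ,(2)} = (1/b)·∫_0^1 φ_b^{σ,(2)}`. -/
def PhiS2 {b : ℕ} (σ : Equiv.Perm (Fin b)) : ℝ := (1 / (b : ℝ)) * ∫ x in (0:ℝ)..1, phiS2 σ x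

/-- `Φ̃_b^σ = (1/b)·∫_0^1 φ̃_b^σ`. -/
def PhiT {b : ℕ} (σ : Equiv.Perm (Fin b)) : ℝ := (1 / (b : ℝ)) * ∫ x in (0:ℝ)..1, phiT σ x

/-- `Φ̃_{b,1}^σ = (1/b)·∫_0^1 φ̃_{b,1}^σ`. -/
def PhiT1 {b : ℕ} (σ : Equiv.Perm (Fin b)) : ℝ := (1 / (b : ℝ)) * ∫ x in (0:ℝ)..1, phiT1 σ x

/-- `Φ̃_{b,2}^σ = (1/b)·∫_0^1 φ̃_{b,2}^σ`. -/
def PhiT2 {b : ℕ} (σ : Equiv.Perm (Fin b)) : ℝ := (1 / (b : ℝ)) * ∫ x in (0:ℝ)..1, phiT2 σ x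

/-- `ν_j(N,Σ) = σ_j(N_j)·b^{n−j−1} + … + σ_{n−1}(N_{n−1})`, where `N_i` is the `i`-th
`b`-adic digit of `N`. -/
def nu (b n : ℕ) (S : Fin n → Equiv.Perm (Fin b)) (N j : ℕ) : ℕ :=
  ∑ i : Fin n,
    if j ≤ (i : ℕ) then permVal (S i) ((N / b ^ (i : ℕ)) % b) * b ^ (n - 1 - (i : ℕ)) else 0

/-- `ε_j(λ,N,Σ)`, for `1 ≤ j ≤ n`: it is `0` when `λ = bⁿ` or `N = bⁿ`; it is the last digit
`λ_n = λ % b` when `j = n`; otherwise, with `Λ_{j−1} = λ % b^{n−j+1}` and `ν_j = ν_j(N,Σ)`,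
it is `0` if `Λ_{j−1} ≤ ν_j`, it is `h` if `ν_j + (h−1)b^{n−j} < Λ_{j−1} ≤ ν_j + h·b^{n−j}`
for some `1 ≤ h < b`, and `0` if `ν_j + (b−1)b^{n−j} < Λ_{j−1} < b^{n−j+1}`. -/
def eps (b n : ℕ) (S : Fin n → Equiv.Perm (Fin b)) (lam N j : ℕ) : ℕ :=
  if lam = b ^ n ∨ N = b ^ n then 0
  else if j = n then lam % b
  else if lam % b ^ (n - j + 1) ≤ nu b n S N j then 0
  else ((lam % b ^ (n - j + 1) - nu b n S N j - 1) / b ^ (n - j) + 1) % b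

/-- The point of the digit-scrambled Hammersley point set `R_{b,n}^Σ` with digits `a`:
`(∑_{j=0}^{n−1} σ_j(a_j)/b^{n−j}, ∑_{j=0}^{n−1} a_j/b^{j+1})`. -/
def hammPt (b n : ℕ) (S : Fin n → Equiv.Perm (Fin b)) (a : Fin n → Fin b) : ℝ × ℝ :=
  (∑ j : Fin n, ((S j (a j) : ℕ) : ℝ) / (b : ℝ) ^ (n - (j : ℕ)),
   ∑ j : Fin n, ((a j : ℕ) : ℝ) / (b : ℝ) ^ ((j : ℕ) + 1))

/-- The symmetrized Hammersley point set `R_{b,n}^{Σ,sym} = R_{b,n}^Σ ∪ R_{b,n}^{Σ*}`,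
a family of `2·bⁿ` points. -/
def symFam (b n : ℕ) (S : Fin n → Equiv.Perm (Fin b)) :
    Bool × (Fin n → Fin b) → ℝ × ℝ :=
  fun p => if p.1 then hammPt b n S p.2 else hammPt b n (fun i => pbar (S i)) p.2

/-- Local discrepancy `E(x,y,P) = #{i : P i ∈ [0,x)×[0,y)} − N·x·y` of a finite family of
points, where `N` is the number of points. -/
def localDisc {ι : Type} [Fintype ι] (P : ι → ℝ × ℝ) (x y : ℝ) : ℝ :=
  ((Finset.univ.filter
      (fun i => 0 ≤ (P i).1 ∧ (P i).1 < x ∧ 0 ≤ (P i).2 ∧ (P i).2 < y)).card : ℝ)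
    - (Fintype.card ι : ℝ) * x * y

/-- `L_2` discrepancy `L2(P) = (1/N)·(∫_0^1∫_0^1 E(x,y,P)² dx dy)^{1/2}`. -/
def L2disc {ι : Type} [Fintype ι] (P : ι → ℝ × ℝ) : ℝ :=
  (1 / (Fintype.card ι : ℝ)) *
    Real.sqrt (∫ x in (0:ℝ)..1, ∫ y in (0:ℝ)..1, (localDisc P x y) ^ 2)

/-- The piecewise linear ramp `x ↦ b·x − l`, clamped to `[0,1]`. -/
def ramp (b l : ℕ) (x : ℝ) : ℝ := max 0 (min 1 ((b : ℝ) * x - l))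

lemma continuous_ramp (b l : ℕ) : Continuous (ramp b l) := by
  unfold ramp; fun_prop

lemma ramp_eq_zero {b l : ℕ} {x : ℝ} (h : (b : ℝ) * x ≤ l) : ramp b l x = 0 :=
  max_eq_left ((min_le_right _ _).trans (by linarith))

lemma ramp_eq_one {b l : ℕ} {x : ℝ} (h : (l : ℝ) + 1 ≤ (b : ℝ) * x) : ramp b l x = 1 := by
  rw [ramp, min_eq_left (by linarith), max_eq_right zero_le_one]

lemma ramp_eq_sub {b l : ℕ} {x : ℝ} (h₁ : (l : ℝ) ≤ (b : ℝ) * x)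
    (h₂ : (b : ℝ) * x ≤ (l : ℝ) + 1) : ramp b l x = (b : ℝ) * x - l := by
  rw [ramp, min_eq_right (by linarith), max_eq_right (by linarith)]

lemma ramp_eq_min_sub_min (b l : ℕ) (x : ℝ) :
    ramp b l x = min ((b : ℝ) * x) ((l + 1 : ℕ) : ℝ) - min ((b : ℝ) * x) (l : ℝ) := by
  push_cast
  rcases le_total ((b : ℝ) * x) l with h | h
  · rw [ramp_eq_zero h, min_eq_left h, min_eq_left (by linarith)]; ring
  · rcases le_total ((b : ℝ) * x) (l + 1) with h' | h'
    · rw [ramp_eq_sub h h', min_eq_left h', min_eq_right h]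
    · rw [ramp_eq_one h', min_eq_right h', min_eq_right h]; ring

lemma sum_ramp (b : ℕ) {x : ℝ} (hx₀ : 0 ≤ x) (hx₁ : x ≤ 1) :
    ∑ l : Fin b, ramp b l x = (b : ℝ) * x := by
  rw [Fin.sum_univ_eq_sum_range (fun l => ramp b l x) b]
  simp_rw [ramp_eq_min_sub_min]
  rw [Finset.sum_range_sub (fun l : ℕ => min ((b : ℝ) * x) (l : ℝ))]
  have hb : (0 : ℝ) ≤ b := Nat.cast_nonneg b
  rw [min_eq_left (by nlinarith), Nat.cast_zero, min_eq_right (by positivity), sub_zero]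

lemma ramp_mul_ramp_of_lt {b l l' : ℕ} (h : l < l') (x : ℝ) :
    ramp b l x * ramp b l' x = ramp b l' x := by
  have h' : (l : ℝ) + 1 ≤ l' := by exact_mod_cast h
  rcases le_total ((b : ℝ) * x) l' with hx | hx
  · rw [ramp_eq_zero hx, mul_zero]
  · rw [ramp_eq_one (h'.trans hx), one_mul]

lemma integral_ramp_pow {b l : ℕ} (hl : l < b) (n : ℕ) (hn : n ≠ 0) :
    ∫ x in (0 : ℝ)..1, ramp b l x ^ n = (1 / ((n : ℝ) + 1) + ((b : ℝ) - 1 - l)) / b := by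
  have hb : (0 : ℝ) < b := by exact_mod_cast (Nat.zero_le l).trans_lt hl
  have hlb : (l : ℝ) + 1 ≤ b := by exact_mod_cast hl
  have hi : ∀ u v : ℝ, IntervalIntegrable (fun x => ramp b l x ^ n) MeasureTheory.volume u v :=
    fun u v => ((continuous_ramp b l).pow n).intervalIntegrable u v
  have h₀ : (0 : ℝ) ≤ l / b := by positivity
  have h₁ : (l : ℝ) / b ≤ (l + 1) / b := by gcongr; linarith
  have h₂ : ((l : ℝ) + 1) / b ≤ 1 := by rwa [div_le_one hb]
  rw [← intervalIntegral.integral_add_adjacent_intervals (hi 0 (l / b)) (hi _ 1),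
    ← intervalIntegral.integral_add_adjacent_intervals (hi (l / b) ((l + 1) / b)) (hi _ 1)]
  have e₁ : ∫ x in (0 : ℝ)..(l / b), ramp b l x ^ n = ∫ x in (0 : ℝ)..(l / b), (0 : ℝ) := by
    refine intervalIntegral.integral_congr fun x hx => ?_
    rw [Set.uIcc_of_le h₀] at hx
    have := (le_div_iff₀ hb).1 hx.2
    simp only [ramp_eq_zero (show (b : ℝ) * x ≤ l by linarith), zero_pow hn]
  have e₂ : ∫ x in ((l : ℝ) / b)..((l + 1) / b), ramp b l x ^ n
      = ∫ x in ((l : ℝ) / b)..((l + 1) / b), ((b : ℝ) * x - l) ^ n := by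
    refine intervalIntegral.integral_congr fun x hx => ?_
    rw [Set.uIcc_of_le h₁] at hx
    have h := (le_div_iff₀ hb).1 hx.2
    have h' := (div_le_iff₀ hb).1 hx.1
    simp only [ramp_eq_sub (show (l : ℝ) ≤ (b : ℝ) * x by linarith) (by linarith)]
  have e₃ : ∫ x in (((l : ℝ) + 1) / b)..1, ramp b l x ^ n
      = ∫ x in (((l : ℝ) + 1) / b)..1, (1 : ℝ) := by
    refine intervalIntegral.integral_congr fun x hx => ?_
    rw [Set.uIcc_of_le h₂] at hx
    have h := (div_le_iff₀ hb).1 hx.1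
    simp only [ramp_eq_one (show (l : ℝ) + 1 ≤ (b : ℝ) * x by linarith), one_pow]
  rw [e₁, e₂, e₃, intervalIntegral.integral_comp_mul_sub (fun y => y ^ n) hb.ne',
    mul_div_cancel₀ _ hb.ne', mul_div_cancel₀ _ hb.ne', sub_self, add_sub_cancel_left,
    integral_pow]
  simp only [intervalIntegral.integral_const, smul_eq_mul, one_pow,
    zero_pow (Nat.succ_ne_zero n)]
  have hn' : (n : ℝ) + 1 ≠ 0 := by positivity
  field_simp
  ring

/-- The continuous form of `phi` on `[0,1]`. -/
def partialDev {b : ℕ} (σ : Equiv.Perm (Fin b)) (h : ℕ) (x : ℝ) : ℝ :=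
  ∑ l : Fin b, if (σ l : ℕ) < h then ramp b l x - x else 0

lemma continuous_partialDev {b : ℕ} (σ : Equiv.Perm (Fin b)) (h : ℕ) :
    Continuous (partialDev σ h) := by
  unfold partialDev
  refine continuous_finsetSum _ fun l _ => ?_
  split_ifs
  · exact (continuous_ramp b l).sub continuous_id
  · exact continuous_const

lemma sum_ramp_sub (b : ℕ) {x : ℝ} (hx₀ : 0 ≤ x) (hx₁ : x ≤ 1) :
    ∑ l : Fin b, (ramp b l x - x) = 0 := by
  rw [Finset.sum_sub_distrib, sum_ramp b hx₀ hx₁]; simp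

lemma partialDev_zero {b : ℕ} (σ : Equiv.Perm (Fin b)) (x : ℝ) : partialDev σ 0 x = 0 := by
  simp [partialDev]

lemma partialDev_self {b : ℕ} (σ : Equiv.Perm (Fin b)) {x : ℝ} (hx₀ : 0 ≤ x) (hx₁ : x ≤ 1) :
    partialDev σ b x = 0 := by
  simp [partialDev, sum_ramp_sub b hx₀ hx₁]

lemma partialDev_succ_sub {b : ℕ} (σ : Equiv.Perm (Fin b)) (j : Fin b) (x : ℝ) :
    partialDev σ (j + 1) x - partialDev σ j x = ramp b (σ.symm j) x - x := by
  unfold partialDev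
  rw [← Finset.sum_sub_distrib, Finset.sum_eq_single (σ.symm j)]
  · simp
  · intro l _ hl
    have : (σ l : ℕ) ≠ j := fun h => hl (by rw [Equiv.eq_symm_apply]; exact Fin.ext h)
    by_cases h : (σ l : ℕ) < j
    · rw [if_pos h, if_pos (by omega), sub_self]
    · rw [if_neg h, if_neg (by omega), sub_self]
  · simp

lemma partialDev_pbar {b : ℕ} (σ : Equiv.Perm (Fin b)) {h : ℕ} (hh : h ≤ b) {x : ℝ}
    (hx₀ : 0 ≤ x) (hx₁ : x ≤ 1) : partialDev (pbar σ) h x = -partialDev σ (b - h) x := by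
  rw [eq_neg_iff_add_eq_zero, ← sum_ramp_sub b hx₀ hx₁, partialDev, partialDev,
    ← Finset.sum_add_distrib]
  refine Finset.sum_congr rfl fun l _ => ?_
  have e : (pbar σ l : ℕ) = b - (σ l + 1) := by
    simp [pbar, tauP, Fin.val_rev]
  have := (σ l).isLt
  rw [e]
  by_cases hl : (σ l : ℕ) < b - h
  · rw [if_pos hl, if_neg (by omega), zero_add]
  · rw [if_neg hl, if_pos (by omega), add_zero]

lemma card_perm_lt {b : ℕ} (σ : Equiv.Perm (Fin b)) {h : ℕ} (hh : h ≤ b) :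
    ∑ l : Fin b, (if (σ l : ℕ) < h then (1 : ℝ) else 0) = h := by
  rw [Equiv.sum_comp σ (fun l : Fin b => if (l : ℕ) < h then (1 : ℝ) else 0),
    Fin.sum_univ_eq_sum_range (fun l => if l < h then (1 : ℝ) else 0) b, Finset.sum_boole]
  congr 1
  rw [show (range b).filter (· < h) = range h by ext; simp; omega, card_range]

lemma phi_eq_partialDev {b : ℕ} (hb : 0 < b) (σ : Equiv.Perm (Fin b)) {h : ℕ} (hh : h ≤ b)
    (x : ℝ) : phi σ h x = partialDev σ h (Int.fract x) := by
  have hb' : (0 : ℝ) < b := by exact_mod_cast hb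
  unfold phi
  set y := Int.fract x
  have hy₀ : 0 ≤ y := Int.fract_nonneg x
  have hy₁ : y < 1 := Int.fract_lt_one x
  rw [show (⌊(b : ℝ) * y⌋).toNat = ⌊(b : ℝ) * y⌋₊ from rfl]
  set m := ⌊(b : ℝ) * y⌋₊
  have hm₁ : (m : ℝ) ≤ b * y := Nat.floor_le (by positivity)
  have hm₂ : (b : ℝ) * y < m + 1 := Nat.lt_floor_add_one _
  have hmb : m < b := by
    have : (m : ℝ) < b := by nlinarith
    exact_mod_cast this
  have count : ∀ (p : ℕ → Prop) [DecidablePred p],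
      (((range (m + 1)).filter (fun l => p (permVal σ l))).card : ℝ)
        = ∑ l : Fin b, if (l : ℕ) ≤ m ∧ p (σ l) then (1 : ℝ) else 0 := by
    intro p _
    have e : ∀ l : Fin b, permVal σ l = σ l := fun l => by simp [permVal]
    simp_rw [← e]
    rw [Fin.sum_univ_eq_sum_range
      (fun l => if l ≤ m ∧ p (permVal σ l) then (1 : ℝ) else 0) b, Finset.sum_boole]
    congr 2
    ext l
    simp only [mem_filter, mem_range]
    constructor
    · rintro ⟨h₁, h₂⟩; exact ⟨by omega, by omega, h₂⟩
    · rintro ⟨-, h₁, h₂⟩; exact ⟨by omega, h₂⟩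
  have ramp_val : ∀ l : Fin b, ramp b l y
      = (if (l : ℕ) ≤ m then 1 else 0) - if l = ⟨m, hmb⟩ then (m + 1 - b * y) else 0 := by
    intro l
    rcases lt_trichotomy (l : ℕ) m with hl | hl | hl
    · have h' : ((l : ℕ) : ℝ) + 1 ≤ m := by exact_mod_cast hl
      rw [ramp_eq_one (by linarith), if_pos hl.le, if_neg (fun h => by simp [h] at hl), sub_zero]
    · have h' : ((l : ℕ) : ℝ) = m := by exact_mod_cast hl
      rw [ramp_eq_sub (by linarith) (by linarith), if_pos hl.le, if_pos (Fin.ext hl), h']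
      ring
    · have h' : (m : ℝ) + 1 ≤ (l : ℕ) := by exact_mod_cast hl
      rw [ramp_eq_zero (by linarith), if_neg (by omega), if_neg (fun h => by simp [h] at hl),
        sub_zero]
  have key : partialDev σ h y
      = (∑ l : Fin b, if (l : ℕ) ≤ m ∧ (σ l : ℕ) < h then (1 : ℝ) else 0)
        - (if (σ ⟨m, hmb⟩ : ℕ) < h then (m + 1 - b * y) else 0) - h * y := by
    have e₁ : (h : ℝ) * y = ∑ l : Fin b, (if (σ l : ℕ) < h then (1 : ℝ) else 0) * y := by
      rw [← Finset.sum_mul, card_perm_lt σ hh]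
    have e₂ : (if (σ ⟨m, hmb⟩ : ℕ) < h then (m + 1 - b * y) else 0)
        = ∑ l : Fin b, if l = ⟨m, hmb⟩ then
          (if (σ l : ℕ) < h then ((m : ℝ) + 1 - b * y) else 0) else 0 := by
      simp
    rw [e₁, e₂, ← Finset.sum_sub_distrib, ← Finset.sum_sub_distrib, partialDev]
    refine Finset.sum_congr rfl fun l _ => ?_
    rw [ramp_val l]
    by_cases h₁ : (σ l : ℕ) < h <;> simp [h₁]
  have pm : permVal σ m = σ ⟨m, hmb⟩ := by simp [permVal, hmb]
  rw [key, pm]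
  by_cases hs : h ≤ (σ ⟨m, hmb⟩ : ℕ)
  · rw [if_pos hs, if_neg (by omega), count (· < h)]
    ring
  · rw [if_neg hs, if_pos (by omega), count (h ≤ ·)]
    have split : (∑ l : Fin b, if (l : ℕ) ≤ m ∧ (σ l : ℕ) < h then (1 : ℝ) else 0)
        + (∑ l : Fin b, if (l : ℕ) ≤ m ∧ h ≤ (σ l : ℕ) then (1 : ℝ) else 0) = m + 1 := by
      have e := count (fun _ => True)
      simp only [Finset.filter_true, card_range, and_true] at e
      push_cast at e
      rw [e, ← Finset.sum_add_distrib]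
      refine Finset.sum_congr rfl fun l _ => ?_
      by_cases h₁ : (l : ℕ) ≤ m <;> by_cases h₂ : (σ l : ℕ) < h <;> simp [h₁, h₂]
    linarith

lemma phi_eq_partialDev_of_mem {b : ℕ} (hb : 0 < b) (σ : Equiv.Perm (Fin b)) {h : ℕ}
    (hh : h ≤ b) {x : ℝ} (hx : x ∈ Set.Icc (0 : ℝ) 1) : phi σ h x = partialDev σ h x := by
  rw [phi_eq_partialDev hb σ hh]
  rcases hx.2.lt_or_eq with h₁ | rfl
  · rw [Int.fract_eq_self.2 ⟨hx.1, h₁⟩]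
  · rw [Int.fract_one]
    refine Finset.sum_congr rfl fun l _ => ?_
    have : ((l : ℕ) : ℝ) + 1 ≤ b := by exact_mod_cast l.isLt
    rw [ramp_eq_zero (by simp), ramp_eq_one (by linarith)]
    simp

/-- Summation by parts for a sequence vanishing at `0` and `n + 1`. -/
lemma reflected_sum_by_parts (n : ℕ) (a : ℕ → ℝ) (h₀ : a 0 = 0) (h₁ : a (n + 1) = 0) :
    (∑ h ∈ range (n + 1), a h * -a (n + 1 - h))
      - 1 / 2 * (∑ h ∈ range n, a (h + 1) * -a (n + 1 - h))
      - 1 / 2 * (∑ h ∈ range n, a h * -a (n + 1 - (h + 1)))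
      = 1 / 2 * ∑ h ∈ range (n + 1), (a (h + 1) - a h) * (a (n + 1 - h) - a (n - h)) := by
  have e₁ : ∑ h ∈ range (n + 1), a (h + 1) * a (n + 1 - h)
      = ∑ h ∈ range n, a (h + 1) * a (n + 1 - h) := by
    rw [Finset.sum_range_succ, h₁]; ring
  have e₂ : ∑ h ∈ range (n + 1), a h * a (n - h) = ∑ h ∈ range n, a h * a (n - h) := by
    rw [Finset.sum_range_succ, Nat.sub_self, h₀]; ring
  have e₃ : ∑ h ∈ range (n + 1), a (h + 1) * a (n - h)
      = ∑ h ∈ range (n + 1), a h * a (n + 1 - h) := by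
    rw [Finset.sum_range_succ, Finset.sum_range_succ' (fun h => a h * a (n + 1 - h)), h₀, h₁]
    simp
  have e₄ : ∑ h ∈ range (n + 1), (a (h + 1) - a h) * (a (n + 1 - h) - a (n - h))
      = ∑ h ∈ range (n + 1), a (h + 1) * a (n + 1 - h)
        - ∑ h ∈ range (n + 1), a (h + 1) * a (n - h)
        - ∑ h ∈ range (n + 1), a h * a (n + 1 - h) + ∑ h ∈ range (n + 1), a h * a (n - h) := by
    rw [← Finset.sum_sub_distrib, ← Finset.sum_sub_distrib, ← Finset.sum_add_distrib]
    exact Finset.sum_congr rfl fun h _ => by ring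
  rw [e₄, e₁, e₂, e₃]
  simp only [mul_neg, Finset.sum_neg_distrib, Nat.add_sub_add_right]
  ring

lemma phiT_sub_eq {b : ℕ} (hb : 0 < b) (σ : Equiv.Perm (Fin b))
    (hcomm : (tauP b).trans σ = σ.trans (tauP b)) {x : ℝ} (hx : x ∈ Set.Icc (0 : ℝ) 1) :
    phiT σ x - 1 / 2 * phiT1 σ x - 1 / 2 * phiT2 σ x
      = 1 / 2 * (∑ l : Fin b, ramp b l x * ramp b (b - 1 - l) x - b * x ^ 2) := by
  obtain ⟨n, rfl⟩ : ∃ n, b = n + 1 := ⟨b - 1, by omega⟩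
  have hT : phiT σ x
      = ∑ h ∈ range (n + 1), partialDev σ h x * -partialDev σ (n + 1 - h) x :=
    Finset.sum_congr rfl fun h hh => by
      have : h < n + 1 := mem_range.1 hh
      rw [phi_eq_partialDev_of_mem hb _ this.le hx, phi_eq_partialDev_of_mem hb _ this.le hx,
        partialDev_pbar σ this.le hx.1 hx.2]
  have hT1 : phiT1 σ x
      = ∑ h ∈ range n, partialDev σ (h + 1) x * -partialDev σ (n + 1 - h) x :=
    Finset.sum_congr rfl fun h hh => by
      have : h < n := mem_range.1 hh
      rw [phi_eq_partialDev_of_mem hb _ (by omega) hx,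
        phi_eq_partialDev_of_mem hb _ (by omega) hx, partialDev_pbar σ (by omega) hx.1 hx.2]
  have hT2 : phiT2 σ x
      = ∑ h ∈ range n, partialDev σ h x * -partialDev σ (n + 1 - (h + 1)) x :=
    Finset.sum_congr rfl fun h hh => by
      have : h < n := mem_range.1 hh
      rw [phi_eq_partialDev_of_mem hb _ (by omega) hx,
        phi_eq_partialDev_of_mem hb _ (by omega) hx, partialDev_pbar σ (by omega) hx.1 hx.2]
  rw [hT, hT1, hT2, reflected_sum_by_parts n (fun h => partialDev σ h x) (partialDev_zero σ x)
    (partialDev_self σ hx.1 hx.2)]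
  congr 1
  have hrev : ∀ l : Fin (n + 1), σ.symm (Fin.rev (σ l)) = Fin.rev l := fun l => by
    rw [Equiv.symm_apply_eq]
    simpa [tauP] using (Equiv.congr_fun hcomm l).symm
  have hval : ∀ l : Fin (n + 1), ((Fin.rev l : Fin (n + 1)) : ℕ) = n + 1 - 1 - l := fun l => by
    rw [Fin.val_rev]; omega
  rw [← Fin.sum_univ_eq_sum_range (fun h => (partialDev σ (h + 1) x - partialDev σ h x)
    * (partialDev σ (n + 1 - h) x - partialDev σ (n - h) x)) (n + 1)]
  have e : ∀ j : Fin (n + 1), (partialDev σ (j + 1) x - partialDev σ j x)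
      * (partialDev σ (n + 1 - j) x - partialDev σ (n - j) x)
      = (ramp (n + 1) (σ.symm j) x - x) * (ramp (n + 1) (σ.symm (Fin.rev j)) x - x) := by
    intro j
    have hj := j.isLt
    rw [← partialDev_succ_sub σ j, ← partialDev_succ_sub σ (Fin.rev j), hval,
      show n + 1 - 1 - (j : ℕ) + 1 = n + 1 - j by omega, Nat.add_sub_cancel]
  simp_rw [e]
  rw [← Equiv.sum_comp σ]
  simp_rw [Equiv.symm_apply_apply, hrev]
  have s₁ := sum_ramp (n + 1) hx.1 hx.2
  have s₂ : ∑ l : Fin (n + 1), ramp (n + 1) (Fin.rev l : Fin (n + 1)) x = ((n + 1 : ℕ) : ℝ) * x :=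
    (Equiv.sum_comp Fin.revPerm (fun l : Fin (n + 1) => ramp (n + 1) l x)).trans s₁
  have e' : ∀ l : Fin (n + 1), (ramp (n + 1) l x - x) * (ramp (n + 1) (Fin.rev l) x - x)
      = ramp (n + 1) l x * ramp (n + 1) (n + 1 - 1 - l) x
        - x * ramp (n + 1) l x - x * ramp (n + 1) (Fin.rev l) x + x ^ 2 := fun l => by
    rw [hval]; ring
  simp_rw [e', Finset.sum_add_distrib, Finset.sum_sub_distrib, ← Finset.mul_sum]
  rw [s₁, s₂]
  simp
  ring

lemma integral_ramp_mul_ramp {b l : ℕ} (hl : l < b) :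
    ∫ x in (0 : ℝ)..1, ramp b l x * ramp b (b - 1 - l) x
      = ((if 2 * l + 1 = b then 1 / 3 else 1 / 2)
        + if 2 * l + 1 ≤ b then (l : ℝ) else (b : ℝ) - 1 - l) / b := by
  have hc : ((b - 1 - l : ℕ) : ℝ) = (b : ℝ) - 1 - l := by
    rw [Nat.cast_sub (by omega), Nat.cast_sub (by omega), Nat.cast_one]
  rcases lt_trichotomy (2 * l + 1) b with h | h | h
  · simp_rw [ramp_mul_ramp_of_lt (b := b) (show l < b - 1 - l by omega)]
    have := integral_ramp_pow (b := b) (l := b - 1 - l) (by omega) 1 one_ne_zero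
    simp only [pow_one] at this
    rw [this, if_neg h.ne, if_pos h.le, hc]
    norm_num
  · have := integral_ramp_pow hl 2 two_ne_zero
    rw [show b - 1 - l = l by omega]
    simp_rw [← sq]
    rw [this, if_pos h, if_pos h.le, ← h]
    push_cast
    ring
  · simp_rw [mul_comm (ramp b l _), ramp_mul_ramp_of_lt (b := b) (show b - 1 - l < l by omega)]
    have := integral_ramp_pow hl 1 one_ne_zero
    simp only [pow_one] at this
    rw [this, if_neg h.ne', if_neg (by omega)]
    norm_num

lemma Phi_sub_eq {b : ℕ} (hb : 0 < b) (σ : Equiv.Perm (Fin b))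
    (hcomm : (tauP b).trans σ = σ.trans (tauP b)) :
    PhiT σ - 1 / 2 * PhiT1 σ - 1 / 2 * PhiT2 σ
      = 1 / (2 * b) * ((∑ l ∈ range b, ((if 2 * l + 1 = b then 1 / 3 else 1 / 2)
        + if 2 * l + 1 ≤ b then (l : ℝ) else (b : ℝ) - 1 - l)) / b - b / 3) := by
  have hint : ∀ (σ' : Equiv.Perm (Fin b)) (s : ℕ) (f g : ℕ → ℕ),
      (∀ h < s, f h ≤ b ∧ g h ≤ b) →
      IntervalIntegrable (fun x => ∑ h ∈ range s, phi σ (f h) x * phi σ' (g h) x)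
        MeasureTheory.volume 0 1 := by
    intro σ' s f g hfg
    have hc : Continuous
        (fun x => ∑ h ∈ range s, partialDev σ (f h) x * partialDev σ' (g h) x) :=
      continuous_finsetSum _ fun h _ =>
        (continuous_partialDev σ (f h)).mul (continuous_partialDev σ' (g h))
    refine (hc.intervalIntegrable 0 1).congr fun x hx => ?_
    rw [Set.uIoc_of_le zero_le_one] at hx
    have hx' : x ∈ Set.Icc (0 : ℝ) 1 := ⟨hx.1.le, hx.2⟩
    refine Finset.sum_congr rfl fun h hh => ?_
    have := hfg h (mem_range.1 hh)
    rw [phi_eq_partialDev_of_mem hb _ this.1 hx', phi_eq_partialDev_of_mem hb _ this.2 hx']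
  have i₀ : IntervalIntegrable (phiT σ) MeasureTheory.volume 0 1 :=
    hint (pbar σ) b (fun h => h) (fun h => h) fun h hh => ⟨hh.le, hh.le⟩
  have i₁ : IntervalIntegrable (phiT1 σ) MeasureTheory.volume 0 1 :=
    hint (pbar σ) (b - 1) (fun h => h + 1) (fun h => h) fun h hh => by omega
  have i₂ : IntervalIntegrable (phiT2 σ) MeasureTheory.volume 0 1 :=
    hint (pbar σ) (b - 1) (fun h => h) (fun h => h + 1) fun h hh => by omega
  have hI : ∫ x in (0 : ℝ)..1, (phiT σ x - 1 / 2 * phiT1 σ x - 1 / 2 * phiT2 σ x)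
      = (∫ x in (0 : ℝ)..1, phiT σ x) - 1 / 2 * (∫ x in (0 : ℝ)..1, phiT1 σ x)
        - 1 / 2 * ∫ x in (0 : ℝ)..1, phiT2 σ x := by
    rw [intervalIntegral.integral_sub (i₀.sub (i₁.const_mul _)) (i₂.const_mul _),
      intervalIntegral.integral_sub i₀ (i₁.const_mul _), intervalIntegral.integral_const_mul,
      intervalIntegral.integral_const_mul]
  have hr : ∀ l : Fin b, Continuous (fun x => ramp b l x * ramp b (b - 1 - l) x) := fun l =>
    (continuous_ramp b l).mul (continuous_ramp b _)
  have hJ : ∫ x in (0 : ℝ)..1, (phiT σ x - 1 / 2 * phiT1 σ x - 1 / 2 * phiT2 σ x)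
      = 1 / 2 * ((∑ l ∈ range b, ((if 2 * l + 1 = b then 1 / 3 else 1 / 2)
        + if 2 * l + 1 ≤ b then (l : ℝ) else (b : ℝ) - 1 - l)) / b - b / 3) := by
    rw [intervalIntegral.integral_congr (g := fun x =>
      1 / 2 * (∑ l : Fin b, ramp b l x * ramp b (b - 1 - l) x - b * x ^ 2))
      fun x hx => phiT_sub_eq hb σ hcomm (by rwa [Set.uIcc_of_le zero_le_one] at hx)]
    rw [intervalIntegral.integral_const_mul, intervalIntegral.integral_sub
      ((continuous_finsetSum _ fun l _ => hr l).intervalIntegrable 0 1)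
      (Continuous.intervalIntegrable (by fun_prop) 0 1),
      intervalIntegral.integral_finsetSum fun l _ => (hr l).intervalIntegrable 0 1,
      intervalIntegral.integral_const_mul, integral_pow]
    simp_rw [integral_ramp_mul_ramp (Fin.isLt _)]
    rw [Finset.sum_div, ← Fin.sum_univ_eq_sum_range (fun l =>
      ((if 2 * l + 1 = b then 1 / 3 else 1 / 2)
        + if 2 * l + 1 ≤ b then (l : ℝ) else (b : ℝ) - 1 - l) / (b : ℝ)) b]
    norm_num
    ring
  have hb' : (b : ℝ) ≠ 0 := by exact_mod_cast hb.ne'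
  rw [PhiT, PhiT1, PhiT2]
  calc _ = 1 / (b : ℝ) * ∫ x in (0 : ℝ)..1,
        (phiT σ x - 1 / 2 * phiT1 σ x - 1 / 2 * phiT2 σ x) := by rw [hI]; ring
    _ = _ := by rw [hJ]; field_simp

lemma sum_range_half_add (m : ℕ) : ∑ i ∈ range m, ((1 : ℝ) / 2 + i) = (m : ℝ) ^ 2 / 2 := by
  induction m with
  | zero => simp
  | succ m ih => rw [Finset.sum_range_succ, ih]; push_cast; ring

lemma sum_range_half_add_reflect (m : ℕ) :
    ∑ i ∈ range m, ((1 : ℝ) / 2 + ((m : ℝ) - 1 - i)) = (m : ℝ) ^ 2 / 2 := by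
  rw [← sum_range_half_add m, ← Finset.sum_range_reflect]
  refine Finset.sum_congr rfl fun i hi => ?_
  have := mem_range.1 hi
  rw [Nat.cast_sub (by omega), Nat.cast_sub (by omega)]
  push_cast
  ring

lemma sum_overlap_even (m : ℕ) :
    ∑ l ∈ range (m + m), ((if 2 * l + 1 = m + m then (1 : ℝ) / 3 else 1 / 2)
      + if 2 * l + 1 ≤ m + m then (l : ℝ) else ((m + m : ℕ) : ℝ) - 1 - l) = (m : ℝ) ^ 2 := by
  rw [Finset.sum_range_add]
  have e₁ : ∀ l ∈ range m, ((if 2 * l + 1 = m + m then (1 : ℝ) / 3 else 1 / 2)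
      + if 2 * l + 1 ≤ m + m then (l : ℝ) else ((m + m : ℕ) : ℝ) - 1 - l) = 1 / 2 + l := by
    intro l hl
    have := mem_range.1 hl
    rw [if_neg (by omega), if_pos (by omega)]
  have e₂ : ∀ l ∈ range m, ((if 2 * (m + l) + 1 = m + m then (1 : ℝ) / 3 else 1 / 2)
      + if 2 * (m + l) + 1 ≤ m + m then ((m + l : ℕ) : ℝ)
        else ((m + m : ℕ) : ℝ) - 1 - ((m + l : ℕ) : ℝ)) = 1 / 2 + ((m : ℝ) - 1 - l) := by
    intro l hl
    rw [if_neg (by omega), if_neg (by omega)]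
    push_cast
    ring
  rw [Finset.sum_congr rfl e₁, Finset.sum_congr rfl e₂, sum_range_half_add,
    sum_range_half_add_reflect]
  ring

lemma sum_overlap_odd (m : ℕ) :
    ∑ l ∈ range (m + 1 + m), ((if 2 * l + 1 = m + 1 + m then (1 : ℝ) / 3 else 1 / 2)
      + if 2 * l + 1 ≤ m + 1 + m then (l : ℝ) else ((m + 1 + m : ℕ) : ℝ) - 1 - l)
      = (m : ℝ) ^ 2 + m + 1 / 3 := by
  rw [Finset.sum_range_add, Finset.sum_range_succ, if_pos (by omega), if_pos (by omega)]
  have e₁ : ∀ l ∈ range m, ((if 2 * l + 1 = m + 1 + m then (1 : ℝ) / 3 else 1 / 2)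
      + if 2 * l + 1 ≤ m + 1 + m then (l : ℝ) else ((m + 1 + m : ℕ) : ℝ) - 1 - l)
      = 1 / 2 + l := by
    intro l hl
    have := mem_range.1 hl
    rw [if_neg (by omega), if_pos (by omega)]
  have e₂ : ∀ l ∈ range m, ((if 2 * (m + 1 + l) + 1 = m + 1 + m then (1 : ℝ) / 3 else 1 / 2)
      + if 2 * (m + 1 + l) + 1 ≤ m + 1 + m then ((m + 1 + l : ℕ) : ℝ)
        else ((m + 1 + m : ℕ) : ℝ) - 1 - ((m + 1 + l : ℕ) : ℝ)) = 1 / 2 + ((m : ℝ) - 1 - l) := by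
    intro l hl
    rw [if_neg (by omega), if_neg (by omega)]
    push_cast
    ring
  rw [Finset.sum_congr rfl e₁, Finset.sum_congr rfl e₂, sum_range_half_add,
    sum_range_half_add_reflect]
  ring

theorem stmt11 (b : ℕ) (hb : 2 ≤ b) (σ : Equiv.Perm (Fin b))
    (hcomm : (tauP b).trans σ = σ.trans (tauP b)) :
    (Even b → PhiT σ - (1 / 2) * PhiT1 σ - (1 / 2) * PhiT2 σ = -(1 / 24))
      ∧ (¬ Even b →
        PhiT σ - (1 / 2) * PhiT1 σ - (1 / 2) * PhiT2 σ =
          -(((b : ℝ) ^ 2 - 1) / (24 * (b : ℝ) ^ 2))) := by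
  have hb₀ : 0 < b := by omega
  rw [Phi_sub_eq hb₀ σ hcomm]
  have hb' : (b : ℝ) ≠ 0 := by exact_mod_cast hb₀.ne'
  constructor
  · rintro ⟨m, rfl⟩
    rw [sum_overlap_even]
    push_cast at hb' ⊢
    have hm : (m : ℝ) ≠ 0 := fun h => hb' (by rw [h, add_zero])
    have h2 : (m : ℝ) + m = 2 * m := by ring
    rw [h2]
    field_simp
    ring
  · intro hodd
    obtain ⟨m, hm⟩ := Nat.not_even_iff_odd.1 hodd
    obtain rfl : b = m + 1 + m := by omega
    rw [sum_overlap_odd]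
    have h2 : ((m + 1 + m : ℕ) : ℝ) = 2 * m + 1 := by push_cast; ring
    rw [h2] at hb' ⊢
    field_simp
    ring

end SymHamm
end
end

section
/- Let b ≥ 2 and let σ be a permutation of {0,…,b−1} with σ∘τ = τ∘σ, where τ(k) = b−1−k. For each n ≥ 1 let Σ_n ∈ {σ,σ̄}^n be arbitrary. Then (2b^n·L2(R_{b,n}^{Σ_n,sym}))/√(log(2b^n)) converges, as n → ∞, to √(c_b^σ/log b), where c_b^σ = 2Φ_b^{σ,(2)} + Φ̃_b^σ + (1/2)Φ̃_{b,1}^σ + (1/2)Φ̃_{b,2}^σ. -/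
open Finset
open scoped Classical

noncomputable section

namespace SymHamm

/-- The numerator `∑_{i<n} σ_i(a_i) b^i` of the first coordinate of the `n`-digit point whose
second coordinate has numerator `M = ∑_{i<n} a_i b^{n-1-i}`. -/
def xIdx {b : ℕ} (S : ℕ → Equiv.Perm (Fin b)) : ℕ → ℕ → ℕ
  | 0, _ => 0
  | n + 1, M => xIdx S n (M / b) + permVal (S n) (M % b) * b ^ n

lemma permVal_of_lt {b : ℕ} (σ : Equiv.Perm (Fin b)) {k : ℕ} (h : k < b) :
    permVal σ k = σ ⟨k, h⟩ := by
  simp [permVal, h]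

lemma permVal_lt {b : ℕ} (hb : 0 < b) (σ : Equiv.Perm (Fin b)) (k : ℕ) : permVal σ k < b := by
  unfold permVal
  split_ifs
  · exact Fin.is_lt _
  · exact hb

lemma permVal_pbar {b : ℕ} (σ : Equiv.Perm (Fin b)) {k : ℕ} (h : k < b) :
    permVal (pbar σ) k + permVal σ k + 1 = b := by
  rw [permVal_of_lt _ h, permVal_of_lt _ h]
  simp only [pbar, tauP, Equiv.trans_apply, Fin.revPerm_apply, Fin.val_rev]
  have := (σ ⟨k, h⟩).is_lt
  omega

lemma pbar_pbar {b : ℕ} (σ : Equiv.Perm (Fin b)) : pbar (pbar σ) = σ := by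
  ext k
  simp [pbar, tauP]

lemma sum_permVal {b : ℕ} (σ : Equiv.Perm (Fin b)) (f : ℕ → ℝ) :
    ∑ d ∈ range b, f (permVal σ d) = ∑ d ∈ range b, f d := by
  rw [Finset.sum_range, Finset.sum_range, ← Equiv.sum_comp σ fun i => f i]
  refine Finset.sum_congr rfl fun i _ => ?_
  rw [permVal_of_lt σ i.is_lt]

lemma sum_range_mul_eq (k m : ℕ) (f : ℕ → ℝ) :
    ∑ i ∈ range (k * m), f i = ∑ q ∈ range k, ∑ s ∈ range m, f (q * m + s) := by
  induction k with
  | zero => simp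
  | succ k ih => rw [Nat.succ_mul, Finset.sum_range_add, ih, Finset.sum_range_succ]

lemma sum_range_pow_succ {b : ℕ} (n : ℕ) (f : ℕ → ℝ) :
    ∑ i ∈ range (b ^ (n + 1)), f i
      = ∑ l ∈ range (b ^ n), ∑ d ∈ range b, f (d * b ^ n + l) := by
  rw [pow_succ', sum_range_mul_eq, Finset.sum_comm]

lemma sum_range_indicator_lt {b h : ℕ} (h_le : h ≤ b) :
    ∑ d ∈ range b, (if d < h then (1 : ℝ) else 0) = h := by
  rw [← Finset.sum_filter]
  have : (range b).filter (fun d => d < h) = range h := by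
    ext d; simp; omega
  simp [this]

lemma xIdx_lt {b : ℕ} (hb : 0 < b) (S : ℕ → Equiv.Perm (Fin b)) (n M : ℕ) :
    xIdx S n M < b ^ n := by
  induction n generalizing M with
  | zero => simp [xIdx]
  | succ n ih =>
    have h1 := ih (M / b)
    have h2 := permVal_lt hb (S n) (M % b)
    rw [xIdx, pow_succ']
    nlinarith [Nat.mul_le_mul_right (b ^ n) (Nat.succ_le_of_lt h2)]

lemma xIdx_pbar {b : ℕ} (hb : 0 < b) (S : ℕ → Equiv.Perm (Fin b)) (n M : ℕ) :
    xIdx (fun i => pbar (S i)) n M + xIdx S n M + 1 = b ^ n := by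
  induction n generalizing M with
  | zero => simp [xIdx]
  | succ n ih =>
    have h1 := ih (M / b)
    have h2 := permVal_pbar (S n) (Nat.mod_lt M hb)
    simp only [xIdx]
    calc _ = (xIdx (fun i => pbar (S i)) n (M / b) + xIdx S n (M / b) + 1)
          + (permVal (pbar (S n)) (M % b) + permVal (S n) (M % b)) * b ^ n := by ring
      _ = (permVal (pbar (S n)) (M % b) + permVal (S n) (M % b) + 1) * b ^ n := by rw [h1]; ring
      _ = _ := by rw [h2, pow_succ']

lemma xIdx_succ_mul_add {b : ℕ} (S : ℕ → Equiv.Perm (Fin b)) (n M : ℕ) {d : ℕ}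
    (hd : d < b) : xIdx S (n + 1) (M * b + d) = xIdx S n M + permVal (S n) d * b ^ n := by
  have h1 : (M * b + d) / b = M := by
    rw [mul_comm, Nat.mul_add_div (by omega), Nat.div_eq_of_lt hd, add_zero]
  have h2 : (M * b + d) % b = d := by
    rw [mul_comm, Nat.mul_add_mod, Nat.mod_eq_of_lt hd]
  rw [xIdx, h1, h2]

lemma sum_xIdx {b : ℕ} (S : ℕ → Equiv.Perm (Fin b)) (n : ℕ) (f : ℕ → ℝ) :
    ∑ M ∈ range (b ^ n), f (xIdx S n M) = ∑ r ∈ range (b ^ n), f r := by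
  induction n generalizing f with
  | zero => simp [xIdx]
  | succ n ih =>
    rw [sum_range_pow_succ n f, pow_succ, sum_range_mul_eq]
    calc _ = ∑ M ∈ range (b ^ n), ∑ d ∈ range b, f (permVal (S n) d * b ^ n + xIdx S n M) := by
          refine Finset.sum_congr rfl fun M _ => Finset.sum_congr rfl fun d hd => ?_
          rw [xIdx_succ_mul_add S n M (Finset.mem_range.1 hd), add_comm]
      _ = ∑ M ∈ range (b ^ n), ∑ d ∈ range b, f (d * b ^ n + xIdx S n M) := by
          refine Finset.sum_congr rfl fun M _ => ?_
          exact sum_permVal (S n) fun d => f (d * b ^ n + xIdx S n M)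
      _ = _ := ih fun r => ∑ d ∈ range b, f (d * b ^ n + r)

/-- The `n`-th digit of `l` plus the carry generated by comparing the lower digits with `r`. -/
def carryDigit (b n r l : ℕ) : ℕ := l / b ^ n % b + if r < l % b ^ n then 1 else 0

lemma carryDigit_le {b : ℕ} (hb : 0 < b) (n r l : ℕ) : carryDigit b n r l ≤ b := by
  have := Nat.mod_lt (l / b ^ n) hb
  unfold carryDigit
  split_ifs <;> omega

lemma add_mul_pow_lt_iff {b n r s l : ℕ} (hr : r < b ^ n) :
    r + s * b ^ n < l % b ^ (n + 1) ↔ s < carryDigit b n r l := by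
  rw [Nat.mod_pow_succ, carryDigit]
  have hB : 0 < b ^ n := by omega
  have hl := Nat.mod_lt l hB
  generalize b ^ n = B at *
  generalize l % B = u at *
  generalize l / B % b = L at *
  split_ifs with h
  · constructor
    · intro h1
      by_contra! h2
      nlinarith [Nat.mul_le_mul_right B h2]
    · intro h1
      nlinarith [Nat.mul_le_mul_right B (Nat.lt_succ_iff.1 h1)]
  · constructor
    · intro h1
      by_contra! h2
      nlinarith [Nat.mul_le_mul_right B h2]
    · intro h1
      nlinarith [Nat.mul_le_mul_right B (Nat.succ_le_of_lt h1)]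

/-- The number of points with second numerator below `N` and first numerator below `l`. -/
def boxCount {b : ℕ} (S : ℕ → Equiv.Perm (Fin b)) (n l N : ℕ) : ℝ :=
  ∑ M ∈ range N, if xIdx S n M < l then 1 else 0

lemma boxCount_succ {b : ℕ} (hb : 0 < b) (S : ℕ → Equiv.Perm (Fin b)) (n l N D : ℕ)
    (hD : D < b) :
    boxCount S (n + 1) (l % b ^ (n + 1)) (N * b + D)
      = boxCount S n (l % b ^ n) N + ((l / b ^ n % b : ℕ) : ℝ) * N
        + ∑ d ∈ range D, if permVal (S n) d < carryDigit b n (xIdx S n N) l then 1 else 0 := by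
  rw [boxCount, Finset.sum_range_add, sum_range_mul_eq]
  congr 1
  · calc _ = ∑ M ∈ range N, ((carryDigit b n (xIdx S n M) l : ℕ) : ℝ) := by
          refine Finset.sum_congr rfl fun M _ => ?_
          rw [← sum_range_indicator_lt (carryDigit_le hb n (xIdx S n M) l),
            ← sum_permVal (S n) fun d => if d < carryDigit b n (xIdx S n M) l then (1 : ℝ) else 0]
          refine Finset.sum_congr rfl fun d hd => ?_
          rw [xIdx_succ_mul_add S n M (Finset.mem_range.1 hd)]
          simp only [add_mul_pow_lt_iff (xIdx_lt hb S n M)]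
      _ = _ := by
          simp only [carryDigit, Nat.cast_add, Finset.sum_add_distrib, boxCount]
          simp
          ring
  · refine Finset.sum_congr rfl fun d hd => ?_
    rw [xIdx_succ_mul_add S n N ((Finset.mem_range.1 hd).trans hD)]
    simp only [add_mul_pow_lt_iff (xIdx_lt hb S n N)]

/-- The first `b`-adic digit of the fractional part of `x`. -/
def digit (b : ℕ) (x : ℝ) : ℕ := (⌊(b : ℝ) * Int.fract x⌋).toNat

lemma digit_eq_natFloor (b : ℕ) (x : ℝ) : digit b x = ⌊(b : ℝ) * Int.fract x⌋₊ := rfl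

lemma digit_lt {b : ℕ} (hb : 0 < b) (x : ℝ) : digit b x < b := by
  rw [digit_eq_natFloor, Nat.floor_lt (by positivity)]
  have : (0 : ℝ) < b := by exact_mod_cast hb
  nlinarith [Int.fract_lt_one x]

lemma natFloor_pow_succ {b : ℕ} (n : ℕ) {y : ℝ} (hy : 0 ≤ y) :
    ⌊(b : ℝ) ^ (n + 1) * y⌋₊ = ⌊(b : ℝ) ^ n * y⌋₊ * b + digit b ((b : ℝ) ^ n * y) := by
  have h0 : (0 : ℝ) ≤ (b : ℝ) ^ n * y := by positivity
  have h1 : (b : ℝ) ^ (n + 1) * y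
      = (b : ℝ) * Int.fract ((b : ℝ) ^ n * y) + ((⌊(b : ℝ) ^ n * y⌋₊ * b : ℕ) : ℝ) := by
    rw [← Int.self_sub_floor, ← natCast_floor_eq_intCast_floor h0]
    push_cast
    ring
  rw [h1, Nat.floor_add_natCast (by positivity), digit_eq_natFloor, add_comm]

lemma phi_eq {b : ℕ} (σ : Equiv.Perm (Fin b)) (h : ℕ) (x : ℝ) :
    phi σ h x = (∑ l ∈ range (digit b x), if permVal σ l < h then (1 : ℝ) else 0)
      + ((b : ℝ) * Int.fract x - digit b x) * (if permVal σ (digit b x) < h then 1 else 0)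
      - h * Int.fract x := by
  have h1 : ((((Finset.range (digit b x + 1)).filter (fun l => permVal σ l < h)).card : ℕ) : ℝ)
      = (∑ l ∈ range (digit b x), if permVal σ l < h then (1 : ℝ) else 0)
        + if permVal σ (digit b x) < h then 1 else 0 := by
    rw [Finset.natCast_card_filter, Finset.sum_range_succ]
  have h2 : ((((Finset.range (digit b x + 1)).filter (fun l => permVal σ l < h)).card : ℕ) : ℝ)
      + (((Finset.range (digit b x + 1)).filter (fun l => h ≤ permVal σ l)).card : ℕ)
      = digit b x + 1 := by
    have := Finset.card_filter_add_card_filter_not (s := Finset.range (digit b x + 1))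
      (fun l => permVal σ l < h)
    simp only [not_lt, Finset.card_range] at this
    exact_mod_cast this
  unfold phi
  change (if h ≤ permVal σ (digit b x) then
      (((Finset.range (digit b x + 1)).filter (fun l => permVal σ l < h)).card : ℝ)
        - (h : ℝ) * Int.fract x
    else ((b : ℝ) - (h : ℝ)) * Int.fract x -
      (((Finset.range (digit b x + 1)).filter (fun l => h ≤ permVal σ l)).card : ℝ)) = _
  split_ifs with h3 h4
  · omega
  · rw [h1, if_neg h4]
    ring
  · rw [h1, if_pos (by assumption)] at h2
    linear_combination -h2
  · omega

lemma phi_zero {b : ℕ} (σ : Equiv.Perm (Fin b)) (x : ℝ) : phi σ 0 x = 0 := by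
  simp [phi_eq]

lemma phi_pbar {b : ℕ} (hb : 0 < b) (σ : Equiv.Perm (Fin b)) {h : ℕ} (h_le : h ≤ b) (x : ℝ) :
    phi (pbar σ) h x = -phi σ (b - h) x := by
  have key : ∀ l < b, (if permVal (pbar σ) l < h then (1 : ℝ) else 0)
      = 1 - if permVal σ l < b - h then 1 else 0 := by
    intro l hl
    have := permVal_pbar σ hl
    split_ifs <;> first | omega | norm_num
  have hd := digit_lt hb x
  rw [phi_eq, phi_eq, key _ hd,
    Finset.sum_congr rfl fun l hl => key l ((Finset.mem_range.1 hl).trans hd),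
    Finset.sum_sub_distrib, Nat.cast_sub h_le]
  simp only [Finset.sum_const, Finset.card_range, nsmul_eq_mul, mul_one]
  ring

lemma phi_self {b : ℕ} (hb : 0 < b) (σ : Equiv.Perm (Fin b)) (x : ℝ) : phi σ b x = 0 := by
  have := phi_pbar hb (pbar σ) le_rfl x
  rwa [pbar_pbar, Nat.sub_self, phi_zero, neg_zero] at this

lemma sum_phi_add_phi_pbar {b : ℕ} (hb : 0 < b) (σ : Equiv.Perm (Fin b)) (x : ℝ) :
    ∑ h ∈ range b, (phi σ h x + phi (pbar σ) h x) = 0 := by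
  have h1 : ∑ h ∈ range b, phi σ (b - h) x = ∑ h ∈ range b, phi σ h x := by
    have := Finset.sum_range_reflect (fun h => phi σ h x) (b + 1)
    rw [Finset.sum_range_succ, Finset.sum_range_succ] at this
    simpa [phi_zero, phi_self hb] using this
  rw [Finset.sum_add_distrib, ← h1, ← Finset.sum_add_distrib]
  refine Finset.sum_eq_zero fun h hh => ?_
  rw [phi_pbar hb σ (Finset.mem_range.1 hh).le, add_neg_cancel]

lemma phiS2_pbar {b : ℕ} (hb : 0 < b) (σ : Equiv.Perm (Fin b)) (x : ℝ) :
    phiS2 (pbar σ) x = phiS2 σ x := by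
  have := Finset.sum_range_reflect (fun h => phi σ h x ^ 2) (b + 1)
  rw [Finset.sum_range_succ, Finset.sum_range_succ] at this
  simp only [add_tsub_cancel_right, Nat.sub_self, phi_zero, phi_self hb] at this
  norm_num at this
  rw [phiS2, phiS2, ← this]
  refine Finset.sum_congr rfl fun h hh => ?_
  rw [phi_pbar hb σ (Finset.mem_range.1 hh).le, neg_sq]

/-- The sum of Faure functions giving, up to a bounded error, the discrepancy of one Hammersley
point set on boxes whose first side has numerator `l`. -/
def faureSum {b : ℕ} (S : ℕ → Equiv.Perm (Fin b)) (n l : ℕ) (y : ℝ) : ℝ :=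
  ∑ j ∈ range n,
    phi (S j) (carryDigit b j (xIdx S j ⌊(b : ℝ) ^ j * y⌋₊) l) ((b : ℝ) ^ j * y)

lemma boxCount_eq {b : ℕ} (hb : 0 < b) (S : ℕ → Equiv.Perm (Fin b)) (n l : ℕ) {y : ℝ}
    (hy : 0 ≤ y) :
    boxCount S n (l % b ^ n) ⌊(b : ℝ) ^ n * y⌋₊ - ((l % b ^ n : ℕ) : ℝ) * y
      = faureSum S n l y - (if xIdx S n ⌊(b : ℝ) ^ n * y⌋₊ < l % b ^ n then 1 else 0)
        * Int.fract ((b : ℝ) ^ n * y) := by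
  induction n with
  | zero => simp [boxCount, faureSum, xIdx, Nat.mod_one]
  | succ n ih =>
    have hd := digit_lt hb ((b : ℝ) ^ n * y)
    have h0 : (0 : ℝ) ≤ (b : ℝ) ^ n * y := by positivity
    have hfr : Int.fract ((b : ℝ) ^ (n + 1) * y)
        = (b : ℝ) * Int.fract ((b : ℝ) ^ n * y) - digit b ((b : ℝ) ^ n * y) := by
      have h0' : (0 : ℝ) ≤ (b : ℝ) ^ (n + 1) * y := by positivity
      rw [← Int.self_sub_floor, ← Int.self_sub_floor, ← natCast_floor_eq_intCast_floor h0,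
        ← natCast_floor_eq_intCast_floor h0', natFloor_pow_succ n hy]
      push_cast
      ring
    have hN : (⌊(b : ℝ) ^ n * y⌋₊ : ℝ) = (b : ℝ) ^ n * y - Int.fract ((b : ℝ) ^ n * y) := by
      rw [← Int.self_sub_floor, ← natCast_floor_eq_intCast_floor h0]
      ring
    rw [hfr, natFloor_pow_succ n hy, boxCount_succ hb _ _ _ _ _ hd, xIdx_succ_mul_add S n _ hd,
      faureSum, Finset.sum_range_succ, ← faureSum, phi_eq, hN]
    simp only [add_mul_pow_lt_iff (xIdx_lt hb S n _)]
    have hmod : ((l % b ^ (n + 1) : ℕ) : ℝ)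
        = ((l % b ^ n : ℕ) : ℝ) + (b : ℝ) ^ n * ((l / b ^ n % b : ℕ) : ℝ) := by
      rw [Nat.mod_pow_succ]
      push_cast
      ring
    have hc : (carryDigit b n (xIdx S n ⌊(b : ℝ) ^ n * y⌋₊) l : ℝ)
        = ((l / b ^ n % b : ℕ) : ℝ)
          + if xIdx S n ⌊(b : ℝ) ^ n * y⌋₊ < l % b ^ n then (1 : ℝ) else 0 := by
      rw [carryDigit]
      push_cast
      rfl
    rw [hmod, hc]
    linear_combination ih

lemma sum_sq_eq_of_orthogonal {b : ℕ} (hb : 0 < b) (D : ℕ → ℕ → ℝ)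
    (hmod : ∀ j l, D j (l % b ^ (j + 1)) = D j l)
    (hzero : ∀ j, ∀ l < b ^ j, ∑ d ∈ range b, D j (d * b ^ j + l) = 0) (n : ℕ) :
    1 / (b : ℝ) ^ n * ∑ l ∈ range (b ^ n), (∑ j ∈ range n, D j l) ^ 2
      = ∑ j ∈ range n,
          1 / (b : ℝ) ^ j * ∑ l ∈ range (b ^ j), 1 / (b : ℝ) * ∑ d ∈ range b,
            D j (d * b ^ j + l) ^ 2 := by
  have hb' : (b : ℝ) ≠ 0 := by positivity
  induction n with
  | zero => simp
  | succ n ih =>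
    have hinner : ∀ l ∈ range (b ^ n), ∑ d ∈ range b, (∑ j ∈ range (n + 1), D j (d * b ^ n + l)) ^ 2
        = b * (∑ j ∈ range n, D j l) ^ 2 + ∑ d ∈ range b, D n (d * b ^ n + l) ^ 2 := by
      intro l hl
      have hD : ∀ d, ∑ j ∈ range n, D j (d * b ^ n + l) = ∑ j ∈ range n, D j l := by
        intro d
        refine Finset.sum_congr rfl fun j hj => ?_
        have hdvd : b ^ (j + 1) ∣ d * b ^ n :=
          Dvd.dvd.mul_left (pow_dvd_pow b (Finset.mem_range.1 hj)) d
        rw [← hmod j (d * b ^ n + l), ← hmod j l, Nat.add_mod, Nat.mod_eq_zero_of_dvd hdvd,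
          zero_add, Nat.mod_mod]
      simp only [Finset.sum_range_succ, hD, add_sq, Finset.sum_add_distrib, ← Finset.mul_sum]
      rw [hzero n l (Finset.mem_range.1 hl)]
      simp
    rw [Finset.sum_range_succ, ← ih, sum_range_pow_succ, Finset.sum_congr rfl hinner,
      Finset.sum_add_distrib, ← Finset.mul_sum, ← Finset.mul_sum, pow_succ]
    field_simp

lemma carryDigit_mod (b j r l : ℕ) : carryDigit b j r (l % b ^ (j + 1)) = carryDigit b j r l := by
  rw [carryDigit, carryDigit, Nat.mod_mod_of_dvd _ (pow_dvd_pow b j.le_succ), pow_succ,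
    Nat.mod_mul_right_div_self, Nat.mod_mod]

lemma carryDigit_mul_pow_add {b j l d : ℕ} (r : ℕ) (hl : l < b ^ j) (hd : d < b) :
    carryDigit b j r (d * b ^ j + l) = d + if r < l then 1 else 0 := by
  have h0 : 0 < b ^ j := by omega
  rw [carryDigit, Nat.mul_add_mod', Nat.mod_eq_of_lt hl, mul_comm d, Nat.mul_add_div h0,
    Nat.div_eq_of_lt hl, add_zero, Nat.mod_eq_of_lt hd]

lemma sum_range_add_one_eq {b : ℕ} {f : ℕ → ℝ} (h : f 0 = f b) :
    ∑ d ∈ range b, f (d + 1) = ∑ d ∈ range b, f d := by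
  have h1 := Finset.sum_range_succ f b
  rw [Finset.sum_range_succ', h] at h1
  exact add_right_cancel h1

lemma sum_range_pred {b : ℕ} (hb : 0 < b) {f : ℕ → ℝ} (h : f (b - 1) = 0) :
    ∑ d ∈ range b, f d = ∑ d ∈ range (b - 1), f d := by
  obtain ⟨k, rfl⟩ : ∃ k, b = k + 1 := ⟨b - 1, by omega⟩
  rw [Finset.sum_range_succ]
  simpa using h

lemma sum_phi_carry {b : ℕ} (hb : 0 < b) (σ : Equiv.Perm (Fin b)) (x : ℝ) (p q : Prop)
    [Decidable p] [Decidable q] :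
    ∑ d ∈ range b, (phi σ (d + if p then 1 else 0) x + phi (pbar σ) (d + if q then 1 else 0) x)
      = 0 := by
  rw [← sum_phi_add_phi_pbar hb σ x, Finset.sum_add_distrib, Finset.sum_add_distrib]
  have h1 : ∀ (σ : Equiv.Perm (Fin b)) (p : Prop) [Decidable p],
      ∑ d ∈ range b, phi σ (d + if p then 1 else 0) x = ∑ d ∈ range b, phi σ d x := by
    intro σ p _
    split_ifs
    · exact sum_range_add_one_eq (f := fun d => phi σ d x) (by simp [phi_zero, phi_self hb])
    · simp
  rw [h1, h1]

lemma sum_phi_carry_sq {b : ℕ} (hb : 0 < b) (σ : Equiv.Perm (Fin b)) (x : ℝ) (p q : Prop)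
    [Decidable p] [Decidable q] :
    ∑ d ∈ range b,
        (phi σ (d + if p then 1 else 0) x + phi (pbar σ) (d + if q then 1 else 0) x) ^ 2
      = 2 * (phiS2 σ x + phiT σ x + (if p ∧ ¬q then 1 else 0) * (phiT1 σ x - phiT σ x)
        + (if q ∧ ¬p then 1 else 0) * (phiT2 σ x - phiT σ x)) := by
  have h1 : ∀ (σ : Equiv.Perm (Fin b)) (p : Prop) [Decidable p],
      ∑ d ∈ range b, phi σ (d + if p then 1 else 0) x ^ 2 = phiS2 σ x := by
    intro σ p _
    split_ifs
    · exact sum_range_add_one_eq (f := fun d => phi σ d x ^ 2) (by simp [phi_zero, phi_self hb])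
    · simp [phiS2]
  have hb1 : b - 1 + 1 = b := by omega
  have h2 : ∑ d ∈ range b, phi σ (d + if p then 1 else 0) x
        * phi (pbar σ) (d + if q then 1 else 0) x
      = phiT σ x + (if p ∧ ¬q then 1 else 0) * (phiT1 σ x - phiT σ x)
        + (if q ∧ ¬p then 1 else 0) * (phiT2 σ x - phiT σ x) := by
    by_cases hp : p <;> by_cases hq : q
    · simp only [hp, hq, if_true, not_true, and_false, if_false, zero_mul, add_zero]
      exact sum_range_add_one_eq (f := fun d => phi σ d x * phi (pbar σ) d x)
        (by simp [phi_zero, phi_self hb])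
    · simp only [hp, hq, phiT1, if_true, if_false, not_true, not_false_eq_true, and_self]
      rw [sum_range_pred hb (by simp [hb1, phi_self hb])]
      simp
    · simp only [hp, hq, phiT2, if_true, if_false, not_true, not_false_eq_true, and_self]
      rw [sum_range_pred hb (by simp [hb1, phi_self hb])]
      simp
    · simp [hp, hq, phiT]
  have h3 : ∀ a c : ℝ, (a + c) ^ 2 = a ^ 2 + c ^ 2 + 2 * (a * c) := fun a c => by ring
  simp only [h3, Finset.sum_add_distrib, ← Finset.mul_sum]
  rw [h1, h1, h2, phiS2_pbar hb]
  ring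

lemma sum_range_indicator_Ioc {B r s : ℕ} (hs : s < B) :
    ∑ l ∈ range B, (if r < l ∧ ¬s < l then (1 : ℝ) else 0) = ((s - r : ℕ) : ℝ) := by
  rw [← Finset.sum_filter]
  have : (range B).filter (fun l => r < l ∧ ¬s < l) = Finset.Ioc r s := by
    ext l; simp; omega
  rw [this, Finset.sum_const, Nat.card_Ioc, nsmul_one]

/-- The sum over both halves of the symmetrized point set of the Faure sums. -/
def symFaureSum {b : ℕ} (S : ℕ → Equiv.Perm (Fin b)) (n l : ℕ) (y : ℝ) : ℝ :=
  faureSum S n l y + faureSum (fun i => pbar (S i)) n l y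

lemma mean_symFaureSum_sq {b : ℕ} (hb : 0 < b) (S : ℕ → Equiv.Perm (Fin b)) (n : ℕ) (y : ℝ) :
    1 / (b : ℝ) ^ n * ∑ l ∈ range (b ^ n), symFaureSum S n l y ^ 2
      = ∑ j ∈ range n, 2 / (b : ℝ) * (phiS2 (S j) ((b : ℝ) ^ j * y) + phiT (S j) ((b : ℝ) ^ j * y)
        + ((b ^ j - 1 - 2 * xIdx S j ⌊(b : ℝ) ^ j * y⌋₊ : ℕ) : ℝ) / (b : ℝ) ^ j
          * (phiT1 (S j) ((b : ℝ) ^ j * y) - phiT (S j) ((b : ℝ) ^ j * y))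
        + ((2 * xIdx S j ⌊(b : ℝ) ^ j * y⌋₊ + 1 - b ^ j : ℕ) : ℝ) / (b : ℝ) ^ j
          * (phiT2 (S j) ((b : ℝ) ^ j * y) - phiT (S j) ((b : ℝ) ^ j * y))) := by
  have hb' : (b : ℝ) ≠ 0 := by positivity
  simp only [symFaureSum, faureSum, ← Finset.sum_add_distrib]
  rw [sum_sq_eq_of_orthogonal hb fun j l =>
    phi (S j) (carryDigit b j (xIdx S j ⌊(b : ℝ) ^ j * y⌋₊) l) ((b : ℝ) ^ j * y)
    + phi (pbar (S j)) (carryDigit b j (xIdx (fun i => pbar (S i)) j ⌊(b : ℝ) ^ j * y⌋₊) l)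
      ((b : ℝ) ^ j * y)]
  · refine Finset.sum_congr rfl fun j _ => ?_
    have hX := xIdx_pbar hb S j ⌊(b : ℝ) ^ j * y⌋₊
    generalize xIdx (fun i => pbar (S i)) j ⌊(b : ℝ) ^ j * y⌋₊ = s at *
    generalize xIdx S j ⌊(b : ℝ) ^ j * y⌋₊ = r at *
    generalize (b : ℝ) ^ j * y = x at *
    calc _ = 1 / (b : ℝ) ^ j * ∑ l ∈ range (b ^ j), 1 / (b : ℝ)
          * (2 * (phiS2 (S j) x + phiT (S j) x
            + (if r < l ∧ ¬s < l then 1 else 0) * (phiT1 (S j) x - phiT (S j) x)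
            + (if s < l ∧ ¬r < l then 1 else 0) * (phiT2 (S j) x - phiT (S j) x))) := by
          congr 1
          refine Finset.sum_congr rfl fun l hl => ?_
          rw [← sum_phi_carry_sq hb]
          congr 1
          refine Finset.sum_congr rfl fun d hd => ?_
          rw [carryDigit_mul_pow_add _ (Finset.mem_range.1 hl) (Finset.mem_range.1 hd),
            carryDigit_mul_pow_add _ (Finset.mem_range.1 hl) (Finset.mem_range.1 hd)]
      _ = _ := by
          simp only [← Finset.mul_sum, Finset.sum_add_distrib, ← Finset.sum_mul]
          rw [sum_range_indicator_Ioc (by omega), sum_range_indicator_Ioc (by omega),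
            show b ^ j - 1 - 2 * r = s - r by omega, show 2 * r + 1 - b ^ j = r - s by omega]
          simp only [Finset.sum_const, Finset.card_range, nsmul_eq_mul, Nat.cast_pow]
          field_simp
  · intro j l
    simp only [carryDigit_mod]
  · intro j l hl
    rw [← sum_phi_carry hb (S j) ((b : ℝ) ^ j * y) (xIdx S j ⌊(b : ℝ) ^ j * y⌋₊ < l)
      (xIdx (fun i => pbar (S i)) j ⌊(b : ℝ) ^ j * y⌋₊ < l)]
    refine Finset.sum_congr rfl fun d hd => ?_
    rw [carryDigit_mul_pow_add _ hl (Finset.mem_range.1 hd),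
      carryDigit_mul_pow_add _ hl (Finset.mem_range.1 hd)]

/-- Measurable functions that are bounded. -/
def MeasBdd {α : Type*} [MeasurableSpace α] (f : α → ℝ) : Prop :=
  Measurable f ∧ ∃ C, ∀ x, |f x| ≤ C

namespace MeasBdd

variable {α β : Type*} [MeasurableSpace α] [MeasurableSpace β] {f g : α → ℝ}

lemma const (c : ℝ) : MeasBdd fun _ : α => c := ⟨measurable_const, |c|, fun _ => le_rfl⟩

lemma add (hf : MeasBdd f) (hg : MeasBdd g) : MeasBdd fun x => f x + g x := by
  obtain ⟨C, hC⟩ := hf.2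
  obtain ⟨D, hD⟩ := hg.2
  exact ⟨hf.1.add hg.1, C + D, fun x => (abs_add_le _ _).trans (add_le_add (hC x) (hD x))⟩

lemma mul (hf : MeasBdd f) (hg : MeasBdd g) : MeasBdd fun x => f x * g x := by
  obtain ⟨C, hC⟩ := hf.2
  obtain ⟨D, hD⟩ := hg.2
  refine ⟨hf.1.mul hg.1, C * D, fun x => ?_⟩
  rw [abs_mul]
  exact mul_le_mul (hC x) (hD x) (abs_nonneg _) ((abs_nonneg _).trans (hC x))

lemma sub (hf : MeasBdd f) (hg : MeasBdd g) : MeasBdd fun x => f x - g x := by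
  simpa [sub_eq_add_neg] using hf.add ((const (-1)).mul hg)

lemma sq (hf : MeasBdd f) : MeasBdd fun x => f x ^ 2 := by
  simpa [_root_.sq] using hf.mul hf

lemma sum {ι : Type*} {s : Finset ι} {F : ι → α → ℝ} (hF : ∀ i ∈ s, MeasBdd (F i)) :
    MeasBdd fun x => ∑ i ∈ s, F i x := by
  induction s using Finset.induction_on with
  | empty => simpa using const 0
  | insert i s hi ih =>
    simp only [Finset.sum_insert hi]
    exact (hF i (by simp)).add (ih fun k hk => hF k (by simp [hk]))

lemma comp (hf : MeasBdd f) {u : β → α} (hu : Measurable u) : MeasBdd fun x => f (u x) :=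
  ⟨hf.1.comp hu, hf.2.imp fun _ h _ => h _⟩

lemma integrable (hf : MeasBdd f) (μ : MeasureTheory.Measure α)
    [MeasureTheory.IsFiniteMeasure μ] : MeasureTheory.Integrable f μ := by
  obtain ⟨C, hC⟩ := hf.2
  exact MeasureTheory.Integrable.of_bound hf.1.aestronglyMeasurable C
    (Filter.Eventually.of_forall hC)

lemma intervalIntegrable {f : ℝ → ℝ} (hf : MeasBdd f) (u v : ℝ) :
    IntervalIntegrable f MeasureTheory.volume u v :=
  ⟨hf.integrable _, hf.integrable _⟩

end MeasBdd

lemma measurable_of_digit_fract {f : ℕ → ℝ → ℝ} (hf : ∀ k, Measurable (f k)) (b : ℕ) :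
    Measurable fun x => f (digit b x) (Int.fract x) := by
  have h1 : Measurable (Function.uncurry f) := measurable_from_prod_countable_right hf
  have h2 : Measurable (digit b) := by
    have : digit b = fun x => ⌊(b : ℝ) * Int.fract x⌋₊ := funext (digit_eq_natFloor b)
    rw [this]
    exact Nat.measurable_floor.comp (measurable_fract.const_mul _)
  exact h1.comp (h2.prodMk measurable_fract)

lemma measBdd_phi {b : ℕ} (hb : 0 < b) (σ : Equiv.Perm (Fin b)) (h : ℕ) :
    MeasBdd (phi σ h) := by
  constructor
  · have hm := measurable_of_digit_fract (f := fun N z =>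
        (∑ l ∈ range N, if permVal σ l < h then (1 : ℝ) else 0)
        + ((b : ℝ) * z - N) * (if permVal σ N < h then 1 else 0) - h * z)
        (fun k => by fun_prop) b
    rwa [show phi σ h = _ from funext (phi_eq σ h)]
  · refine ⟨b + b + h, fun x => ?_⟩
    have hN : ((digit b x : ℕ) : ℝ) ≤ b := by exact_mod_cast (digit_lt hb x).le
    have hN0 : (0 : ℝ) ≤ (digit b x : ℕ) := Nat.cast_nonneg _
    have hb0 : (0 : ℝ) ≤ (b : ℕ) := Nat.cast_nonneg _
    have hh0 : (0 : ℝ) ≤ (h : ℕ) := Nat.cast_nonneg _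
    have hz0 := Int.fract_nonneg x
    have hz1 := (Int.fract_lt_one x).le
    have hs0 : (0 : ℝ) ≤ ∑ l ∈ range (digit b x), if permVal σ l < h then (1 : ℝ) else 0 :=
      Finset.sum_nonneg fun _ _ => by split_ifs <;> norm_num
    have hs1 : (∑ l ∈ range (digit b x), if permVal σ l < h then (1 : ℝ) else 0)
        ≤ (digit b x : ℕ) := by
      calc _ ≤ ∑ l ∈ range (digit b x), (1 : ℝ) :=
            Finset.sum_le_sum fun _ _ => by split_ifs <;> norm_num
        _ = _ := by simp
    have h1 : (b : ℝ) * Int.fract x ≤ b := mul_le_of_le_one_right hb0 hz1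
    have h2 : (0 : ℝ) ≤ (b : ℝ) * Int.fract x := mul_nonneg hb0 hz0
    have h3 : (h : ℝ) * Int.fract x ≤ h := mul_le_of_le_one_right hh0 hz1
    have h4 : (0 : ℝ) ≤ (h : ℝ) * Int.fract x := mul_nonneg hh0 hz0
    rw [phi_eq, abs_le]
    split_ifs <;> constructor <;> linarith

lemma measBdd_phiS2 {b : ℕ} (hb : 0 < b) (σ : Equiv.Perm (Fin b)) : MeasBdd (phiS2 σ) :=
  MeasBdd.sum fun h _ => (measBdd_phi hb σ h).sq

lemma measBdd_phiT {b : ℕ} (hb : 0 < b) (σ : Equiv.Perm (Fin b)) : MeasBdd (phiT σ) :=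
  MeasBdd.sum fun h _ => (measBdd_phi hb σ h).mul (measBdd_phi hb _ h)

lemma measBdd_phiT1 {b : ℕ} (hb : 0 < b) (σ : Equiv.Perm (Fin b)) : MeasBdd (phiT1 σ) :=
  MeasBdd.sum fun h _ => (measBdd_phi hb σ (h + 1)).mul (measBdd_phi hb _ h)

lemma measBdd_phiT2 {b : ℕ} (hb : 0 < b) (σ : Equiv.Perm (Fin b)) : MeasBdd (phiT2 σ) :=
  MeasBdd.sum fun h _ => (measBdd_phi hb σ h).mul (measBdd_phi hb _ (h + 1))

lemma phi_periodic {b : ℕ} (σ : Equiv.Perm (Fin b)) (h : ℕ) : Function.Periodic (phi σ h) 1 := by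
  intro x
  simp only [phi, Int.fract_add_one]

lemma integral_natFloor_comp {B : ℕ} (hB : 0 < B) (H : ℕ → ℝ → ℝ)
    (hper : ∀ M, Function.Periodic (H M) 1) (hH : ∀ M, MeasBdd (H M)) :
    IntervalIntegrable (fun y => H ⌊(B : ℝ) * y⌋₊ ((B : ℝ) * y)) MeasureTheory.volume 0 1 ∧
    ∫ y in (0:ℝ)..1, H ⌊(B : ℝ) * y⌋₊ ((B : ℝ) * y)
      = 1 / (B : ℝ) * ∑ M ∈ range B, ∫ z in (0:ℝ)..1, H M z := by
  have hB' : (B : ℝ) ≠ 0 := by positivity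
  have hcongr : ∀ M : ℕ, ∀ᵐ z : ℝ, z ∈ Set.uIoc (M : ℝ) ((M + 1 : ℕ) : ℝ) →
      H M z = H ⌊z⌋₊ z := by
    intro M
    filter_upwards [MeasureTheory.Measure.ae_ne MeasureTheory.volume ((M + 1 : ℕ) : ℝ)]
      with z hz hmem
    rw [Set.uIoc_of_le (by norm_num)] at hmem
    have : ⌊z⌋₊ = M := by
      rw [Nat.floor_eq_iff ((Nat.cast_nonneg M).trans hmem.1.le)]
      exact ⟨hmem.1.le, by simpa using lt_of_le_of_ne hmem.2 hz⟩
    rw [this]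
  have hint : ∀ M : ℕ, IntervalIntegrable (fun z => H ⌊z⌋₊ z) MeasureTheory.volume
      (M : ℝ) ((M + 1 : ℕ) : ℝ) := fun M =>
    ((hH M).intervalIntegrable _ _).congr_ae
      ((MeasureTheory.ae_restrict_iff' measurableSet_uIoc).2 (hcongr M))
  constructor
  · have h1 : IntervalIntegrable (fun z => H ⌊z⌋₊ z) MeasureTheory.volume ((0 : ℕ) : ℝ) (B : ℝ) :=
      IntervalIntegrable.trans_iterate (a := fun M : ℕ => (M : ℝ)) fun M _ => hint M
    have h2 := h1.comp_mul_left (c := (B : ℝ))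
    simpa [div_self hB'] using h2
  · rw [intervalIntegral.integral_comp_mul_left (fun z => H ⌊z⌋₊ z) hB', mul_zero, mul_one,
      smul_eq_mul, one_div]
    congr 1
    have h1 := intervalIntegral.sum_integral_adjacent_intervals (n := B)
      (a := fun M : ℕ => (M : ℝ)) (μ := MeasureTheory.volume) fun M _ => hint M
    rw [Nat.cast_zero] at h1
    rw [← h1]
    refine Finset.sum_congr rfl fun M _ => ?_
    rw [← intervalIntegral.integral_congr_ae (hcongr M), Nat.cast_succ,
      (hper M).intervalIntegral_add_eq (M : ℝ) 0, zero_add]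

/-- The probability that two independent uniform residues `r, l` modulo `B` satisfy
`r < l ≤ B - 1 - r`. -/
def carryProb (B : ℕ) : ℝ := (∑ r ∈ range B, ((B - 1 - 2 * r : ℕ) : ℝ)) / (B : ℝ) ^ 2

lemma sum_sub_two_mul_bounds (B : ℕ) :
    (B : ℝ) ^ 2 ≤ 4 * (∑ r ∈ range B, ((B - 1 - 2 * r : ℕ) : ℝ)) + 2 * B ∧
      4 * (∑ r ∈ range B, ((B - 1 - 2 * r : ℕ) : ℝ)) ≤ (B : ℝ) ^ 2 := by
  induction B using Nat.twoStepInduction with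
  | zero => simp
  | one => norm_num
  | more B ih _ =>
    have h : ∑ r ∈ range (B + 2), ((B + 2 - 1 - 2 * r : ℕ) : ℝ)
        = B + 1 + ∑ r ∈ range B, ((B - 1 - 2 * r : ℕ) : ℝ) := by
      rw [Finset.sum_range_succ', Finset.sum_range_succ, show B + 2 - 1 - 2 * (B + 1) = 0 by omega]
      rw [Finset.sum_congr rfl fun r _ => by
        rw [show B + 2 - 1 - 2 * (r + 1) = B - 1 - 2 * r by omega]]
      push_cast [show B + 2 - 1 - 2 * 0 = B + 1 by omega]
      ring
    rw [h]
    push_cast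
    constructor <;> nlinarith [ih.1, ih.2]

lemma tendsto_carryProb : Filter.Tendsto carryProb Filter.atTop (nhds (1 / 4)) := by
  have h0 : Filter.Tendsto (fun B : ℕ => (1 / 4 : ℝ) - 1 / 2 * (1 / (B : ℝ))) Filter.atTop
      (nhds (1 / 4)) := by
    have := ((tendsto_one_div_atTop_nhds_zero_nat (𝕜 := ℝ)).const_mul (1 / 2)).const_sub (1 / 4)
    rwa [mul_zero, sub_zero] at this
  refine tendsto_of_tendsto_of_tendsto_of_le_of_le' h0 tendsto_const_nhds ?_ ?_
  all_goals
    filter_upwards [Filter.eventually_gt_atTop 0] with B hB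
    have hB' : (0 : ℝ) < B := by exact_mod_cast hB
    obtain ⟨h1, h2⟩ := sum_sub_two_mul_bounds B
    unfold carryProb
  · rw [le_div_iff₀ (by positivity)]
    have : (1 / 4 - 1 / 2 * (1 / (B : ℝ))) * (B : ℝ) ^ 2 = 1 / 4 * (B : ℝ) ^ 2 - 1 / 2 * B := by
      field_simp
    rw [this]
    linarith
  · rw [div_le_iff₀ (by positivity)]
    linarith

lemma phi_pbar_symm {b : ℕ} (σ : Equiv.Perm (Fin b)) :
    phiT (pbar σ) = phiT σ ∧ phiT1 (pbar σ) = phiT2 σ ∧ phiT2 (pbar σ) = phiT1 σ := by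
  refine ⟨?_, ?_, ?_⟩ <;> funext x <;>
    simp only [phiT, phiT1, phiT2, pbar_pbar] <;>
    exact Finset.sum_congr rfl fun _ _ => mul_comm _ _

lemma integral_mean_symFaureSum_sq {b : ℕ} (hb : 0 < b) (σ : Equiv.Perm (Fin b))
    (S : ℕ → Equiv.Perm (Fin b)) (hS : ∀ j, S j = σ ∨ S j = pbar σ) (n : ℕ) :
    ∫ y in (0:ℝ)..1, 1 / (b : ℝ) ^ n * ∑ l ∈ range (b ^ n), symFaureSum S n l y ^ 2
      = ∑ j ∈ range n, 2 * (PhiS2 σ + PhiT σ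
        + carryProb (b ^ j) * (PhiT1 σ + PhiT2 σ - 2 * PhiT σ)) := by
  have hb' : (b : ℝ) ≠ 0 := by positivity
  let H : ℕ → ℕ → ℝ → ℝ := fun j M z => 2 / (b : ℝ) * (phiS2 (S j) z + phiT (S j) z
        + ((b ^ j - 1 - 2 * xIdx S j M : ℕ) : ℝ) / (b : ℝ) ^ j
          * (phiT1 (S j) z - phiT (S j) z)
        + ((2 * xIdx S j M + 1 - b ^ j : ℕ) : ℝ) / (b : ℝ) ^ j
          * (phiT2 (S j) z - phiT (S j) z))
  have hper : ∀ j M, Function.Periodic (H j M) 1 := by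
    intro j M z
    simp only [H, phiS2, phiT, phiT1, phiT2, phi_periodic _ _ z]
  have hH : ∀ j M, MeasBdd (H j M) := fun j M =>
    (MeasBdd.const _).mul ((((measBdd_phiS2 hb _).add (measBdd_phiT hb _)).add
      ((MeasBdd.const _).mul ((measBdd_phiT1 hb _).sub (measBdd_phiT hb _)))).add
      ((MeasBdd.const _).mul ((measBdd_phiT2 hb _).sub (measBdd_phiT hb _))))
  have hpow : ∀ j, (((b ^ j : ℕ)) : ℝ) = (b : ℝ) ^ j := fun j => by push_cast; rfl
  have hint : ∀ j M, ∫ z in (0:ℝ)..1, H j M z = 2 * (PhiS2 (S j) + PhiT (S j)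
        + ((b ^ j - 1 - 2 * xIdx S j M : ℕ) : ℝ) / (b : ℝ) ^ j * (PhiT1 (S j) - PhiT (S j))
        + ((2 * xIdx S j M + 1 - b ^ j : ℕ) : ℝ) / (b : ℝ) ^ j
          * (PhiT2 (S j) - PhiT (S j))) := by
    intro j M
    have i2 := (measBdd_phiS2 hb (S j)).intervalIntegrable 0 1
    have iT := (measBdd_phiT hb (S j)).intervalIntegrable 0 1
    have iT1 := (measBdd_phiT1 hb (S j)).intervalIntegrable 0 1
    have iT2 := (measBdd_phiT2 hb (S j)).intervalIntegrable 0 1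
    simp only [H, PhiS2, PhiT, PhiT1, PhiT2]
    rw [intervalIntegral.integral_const_mul,
      intervalIntegral.integral_add ((i2.add iT).add ((iT1.sub iT).const_mul _))
        ((iT2.sub iT).const_mul _),
      intervalIntegral.integral_add (i2.add iT) ((iT1.sub iT).const_mul _),
      intervalIntegral.integral_add i2 iT, intervalIntegral.integral_const_mul,
      intervalIntegral.integral_const_mul, intervalIntegral.integral_sub iT1 iT,
      intervalIntegral.integral_sub iT2 iT]
    ring
  have hfloor := fun j => integral_natFloor_comp (pow_pos hb j) (H j) (hper j) (hH j)
  simp only [hpow] at hfloor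
  calc _ = ∫ y in (0:ℝ)..1, ∑ j ∈ range n,
        H j ⌊(b : ℝ) ^ j * y⌋₊ ((b : ℝ) ^ j * y) := by
        simp only [mean_symFaureSum_sq hb, H]
    _ = ∑ j ∈ range n, ∫ y in (0:ℝ)..1, H j ⌊(b : ℝ) ^ j * y⌋₊ ((b : ℝ) ^ j * y) :=
        intervalIntegral.integral_finsetSum fun j _ => (hfloor j).1
    _ = _ := by
        refine Finset.sum_congr rfl fun j _ => ?_
        have h1 : ∑ M ∈ range (b ^ j), ((b ^ j - 1 - 2 * xIdx S j M : ℕ) : ℝ)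
            = carryProb (b ^ j) * ((b : ℝ) ^ j) ^ 2 := by
          rw [sum_xIdx S j fun r => ((b ^ j - 1 - 2 * r : ℕ) : ℝ), carryProb, hpow,
            div_mul_cancel₀ _ (by positivity)]
        have h2 : ∑ M ∈ range (b ^ j), ((2 * xIdx S j M + 1 - b ^ j : ℕ) : ℝ)
            = carryProb (b ^ j) * ((b : ℝ) ^ j) ^ 2 := by
          rw [sum_xIdx S j fun r => ((2 * r + 1 - b ^ j : ℕ) : ℝ), carryProb, hpow,
            div_mul_cancel₀ _ (by positivity), ← Finset.sum_range_reflect]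
          refine Finset.sum_congr rfl fun r hr => ?_
          have := Finset.mem_range.1 hr
          congr 1
          omega
        rw [(hfloor j).2]
        simp only [hint, ← Finset.mul_sum, Finset.sum_add_distrib, ← Finset.sum_mul,
          ← Finset.sum_div]
        rw [h1, h2]
        simp only [Finset.sum_const, Finset.card_range, nsmul_eq_mul, hpow]
        have hbj : (b : ℝ) ^ j ≠ 0 := by positivity
        rcases hS j with h | h <;> rw [h]
        · field_simp
          ring
        · have hs : PhiS2 (pbar σ) = PhiS2 σ := by simp only [PhiS2, phiS2_pbar hb]
          obtain ⟨e1, e2, e3⟩ := phi_pbar_symm σ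
          have ht : PhiT (pbar σ) = PhiT σ := by simp only [PhiT, e1]
          have ht1 : PhiT1 (pbar σ) = PhiT2 σ := by simp only [PhiT1, PhiT2, e2]
          have ht2 : PhiT2 (pbar σ) = PhiT1 σ := by simp only [PhiT1, PhiT2, e3]
          rw [hs, ht, ht1, ht2]
          field_simp
          ring

lemma tendsto_mean_carryProb {b : ℕ} (hb : 2 ≤ b) (σ : Equiv.Perm (Fin b)) :
    Filter.Tendsto (fun n : ℕ => (∑ j ∈ range n, 2 * (PhiS2 σ + PhiT σ
        + carryProb (b ^ j) * (PhiT1 σ + PhiT2 σ - 2 * PhiT σ))) / (n : ℝ)) Filter.atTop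
      (nhds (2 * PhiS2 σ + PhiT σ + (1 / 2) * PhiT1 σ + (1 / 2) * PhiT2 σ)) := by
  have h1 : Filter.Tendsto (fun j : ℕ => carryProb (b ^ j)) Filter.atTop (nhds (1 / 4)) :=
    tendsto_carryProb.comp (tendsto_pow_atTop_atTop_of_one_lt (by omega))
  have h2 := (((h1.mul_const (PhiT1 σ + PhiT2 σ - 2 * PhiT σ)).const_add
    (PhiS2 σ + PhiT σ)).const_mul 2).cesaro
  convert h2 using 2
  · exact div_eq_inv_mul _ _
  · ring

lemma sum_digits_eq {b : ℕ} (S : ℕ → Equiv.Perm (Fin b)) (n : ℕ) (G : ℕ → ℕ → ℝ) :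
    ∑ a : Fin n → Fin b, G (∑ i : Fin n, (S i (a i) : ℕ) * b ^ (i : ℕ))
        (∑ i : Fin n, (a i : ℕ) * b ^ (n - 1 - (i : ℕ)))
      = ∑ M ∈ range (b ^ n), G (xIdx S n M) M := by
  induction n generalizing G with
  | zero => simp [xIdx]
  | succ n ih =>
    have hstep : ∑ M ∈ range (b ^ n), ∑ d ∈ range b, G (xIdx S (n + 1) (M * b + d)) (M * b + d)
        = ∑ M ∈ range (b ^ n), ∑ d ∈ range b,
            G (xIdx S n M + permVal (S n) d * b ^ n) (M * b + d) := by
      refine Finset.sum_congr rfl fun M _ => Finset.sum_congr rfl fun d hd => ?_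
      rw [xIdx_succ_mul_add S n M (Finset.mem_range.1 hd)]
    rw [← Equiv.sum_comp (Fin.snocEquiv fun _ => Fin b), Fintype.sum_prod_type_right, pow_succ,
      sum_range_mul_eq, hstep,
      ← ih fun X M => ∑ d ∈ range b, G (X + permVal (S n) d * b ^ n) (M * b + d)]
    refine Finset.sum_congr rfl fun a _ => ?_
    rw [Finset.sum_range]
    refine Finset.sum_congr rfl fun d _ => ?_
    simp only [Fin.snocEquiv_apply, Fin.sum_univ_castSucc, Fin.snoc_castSucc, Fin.snoc_last,
      Fin.val_castSucc, Fin.val_last, permVal_of_lt (S n) d.is_lt]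
    congr 1
    rw [Finset.sum_mul]
    congr 1
    · refine Finset.sum_congr rfl fun i _ => ?_
      rw [mul_assoc, ← pow_succ]
      congr 2
      omega
    · simp

lemma hammPt_eq {b : ℕ} (hb : 0 < b) (n : ℕ) (S : ℕ → Equiv.Perm (Fin b)) (a : Fin n → Fin b) :
    hammPt b n (fun i => S i) a
      = (((∑ i : Fin n, (S i (a i) : ℕ) * b ^ (i : ℕ) : ℕ) : ℝ) / (b : ℝ) ^ n,
        ((∑ i : Fin n, (a i : ℕ) * b ^ (n - 1 - (i : ℕ)) : ℕ) : ℝ) / (b : ℝ) ^ n) := by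
  have hb' : (b : ℝ) ≠ 0 := by positivity
  simp only [hammPt, Nat.cast_sum, Nat.cast_mul, Nat.cast_pow, Finset.sum_div]
  congr 1 <;> refine Finset.sum_congr rfl fun i _ => ?_
  · rw [div_eq_div_iff (by positivity) (by positivity), mul_assoc, ← pow_add,
      Nat.add_sub_cancel' i.is_lt.le]
  · rw [div_eq_div_iff (by positivity) (by positivity), mul_assoc, ← pow_add]
    congr 2
    omega

lemma abs_localDisc_sub_faureSum_le {b : ℕ} (hb : 0 < b) (n : ℕ) (S : ℕ → Equiv.Perm (Fin b))
    {x y : ℝ} (hx0 : 0 ≤ x) (hx1 : x < 1) (hy0 : 0 ≤ y) (hy1 : y < 1) :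
    |localDisc (hammPt b n fun i => S i) x y - faureSum S n ⌊(b : ℝ) ^ n * x⌋₊ y| ≤ 4 := by
  have hB : (0 : ℝ) < (b : ℝ) ^ n := by positivity
  set B : ℝ := (b : ℝ) ^ n with hBdef
  have hcast : ((b ^ n : ℕ) : ℝ) = B := by push_cast; rfl
  set l := ⌊B * x⌋₊ with hl
  set N := ⌊B * y⌋₊ with hN
  have hlB : l < b ^ n := by
    rw [hl, Nat.floor_lt (by positivity), hcast]
    nlinarith
  have hNB : N < b ^ n := by
    rw [hN, Nat.floor_lt (by positivity), hcast]
    nlinarith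
  have hcount : localDisc (hammPt b n fun i => S i) x y
      = (∑ M ∈ range (b ^ n), if (xIdx S n M : ℝ) < B * x ∧ (M : ℝ) < B * y then (1 : ℝ) else 0)
        - B * x * y := by
    rw [← sum_digits_eq S n fun X M => if (X : ℝ) < B * x ∧ (M : ℝ) < B * y then (1 : ℝ) else 0,
      localDisc, Finset.natCast_card_filter]
    congr 1
    · refine Finset.sum_congr rfl fun a _ => ?_
      refine if_congr ?_ rfl rfl
      rw [hammPt_eq hb]
      simp only [← hBdef, div_lt_iff₀' hB]
      exact ⟨fun h => ⟨h.2.1, h.2.2.2⟩, fun h => ⟨by positivity, h.1, by positivity, h.2⟩⟩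
    · simp [hBdef]
  have hbox : boxCount S n l N
      = ∑ M ∈ range (b ^ n), if xIdx S n M < l ∧ M < N then (1 : ℝ) else 0 := by
    rw [boxCount, ← Finset.sum_filter, ← Finset.sum_filter]
    refine Finset.sum_congr ?_ fun _ _ => rfl
    ext M
    simp only [Finset.mem_filter, Finset.mem_range]
    omega
  have hterm : ∀ M, (if xIdx S n M < l ∧ M < N then (1 : ℝ) else 0)
        ≤ (if (xIdx S n M : ℝ) < B * x ∧ (M : ℝ) < B * y then (1 : ℝ) else 0) ∧
      (if (xIdx S n M : ℝ) < B * x ∧ (M : ℝ) < B * y then (1 : ℝ) else 0)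
        ≤ (if xIdx S n M < l ∧ M < N then (1 : ℝ) else 0)
          + ((if xIdx S n M = l then 1 else 0) + (if M = N then 1 else 0)) := by
    intro M
    have hxl : xIdx S n M < l → (xIdx S n M : ℝ) < B * x := fun h =>
      (Nat.cast_lt.2 h).trans_le (Nat.floor_le (by positivity))
    have hyN : M < N → (M : ℝ) < B * y := fun h =>
      (Nat.cast_lt.2 h).trans_le (Nat.floor_le (by positivity))
    have hxl' : (xIdx S n M : ℝ) < B * x → xIdx S n M ≤ l := fun h => Nat.le_floor h.le
    have hyN' : (M : ℝ) < B * y → M ≤ N := fun h => Nat.le_floor h.le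
    constructor
    · split_ifs with h1 h2
      · rfl
      · exact absurd ⟨hxl h1.1, hyN h1.2⟩ h2
      · norm_num
      · rfl
    · by_cases h1 : (xIdx S n M : ℝ) < B * x ∧ (M : ℝ) < B * y
      · have hx := hxl' h1.1
        have hy := hyN' h1.2
        rw [if_pos h1]
        split_ifs <;> first | omega | norm_num
      · rw [if_neg h1]
        split_ifs <;> norm_num
  have hlow := Finset.sum_le_sum fun M (_ : M ∈ range (b ^ n)) => (hterm M).1
  have hup := Finset.sum_le_sum fun M (_ : M ∈ range (b ^ n)) => (hterm M).2
  rw [Finset.sum_add_distrib, Finset.sum_add_distrib,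
    sum_xIdx S n fun X => if X = l then (1 : ℝ) else 0, Finset.sum_ite_eq', Finset.sum_ite_eq',
    if_pos (Finset.mem_range.2 hlB), if_pos (Finset.mem_range.2 hNB)] at hup
  rw [← hbox] at hlow hup
  have hF := boxCount_eq hb S n l hy0
  rw [Nat.mod_eq_of_lt hlB, ← hBdef, ← hN] at hF
  have hfr0 := Int.fract_nonneg (B * y)
  have hfr1 := (Int.fract_lt_one (B * y)).le
  have hl1 : (l : ℝ) * y ≤ B * x * y :=
    mul_le_mul_of_nonneg_right (Nat.floor_le (by positivity)) hy0
  have hl2 : B * x * y ≤ (l : ℝ) * y + 1 := by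
    have := (Nat.lt_floor_add_one (B * x)).le
    nlinarith
  rw [hcount, abs_le]
  split_ifs at hF <;> constructor <;> linarith

lemma localDisc_symFam {b n : ℕ} (S : Fin n → Equiv.Perm (Fin b)) (x y : ℝ) :
    localDisc (symFam b n S) x y
      = localDisc (hammPt b n S) x y + localDisc (hammPt b n fun i => pbar (S i)) x y := by
  simp only [localDisc, Finset.natCast_card_filter, Fintype.card_prod, Fintype.card_bool]
  rw [Fintype.sum_prod_type, Fintype.sum_bool]
  simp only [symFam, if_true, Bool.false_eq_true, if_false]
  push_cast
  ring

lemma abs_localDisc_symFam_sub_le {b : ℕ} (hb : 0 < b) (n : ℕ) (S : ℕ → Equiv.Perm (Fin b))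
    {x y : ℝ} (hx0 : 0 ≤ x) (hx1 : x < 1) (hy0 : 0 ≤ y) (hy1 : y < 1) :
    |localDisc (symFam b n fun i => S i) x y - symFaureSum S n ⌊(b : ℝ) ^ n * x⌋₊ y| ≤ 8 := by
  have h1 := abs_localDisc_sub_faureSum_le hb n S hx0 hx1 hy0 hy1
  have h2 := abs_localDisc_sub_faureSum_le hb n (fun i => pbar (S i)) hx0 hx1 hy0 hy1
  rw [localDisc_symFam, symFaureSum, add_sub_add_comm]
  exact (abs_add_le _ _).trans (by linarith)

lemma MeasBdd.select {α : Type*} [MeasurableSpace α] {b : ℕ} {f : ℕ → α → ℝ} {k : α → ℕ}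
    (hk : Measurable k) (hkb : ∀ a, k a ≤ b) (hf : ∀ i, MeasBdd (f i)) :
    MeasBdd fun a => f (k a) a := by
  have h1 : (fun a => f (k a) a)
      = fun a => ∑ i ∈ range (b + 1), (if k a = i then (1 : ℝ) else 0) * f i a := by
    funext a
    simp [hkb a]
  rw [h1]
  refine MeasBdd.sum fun i _ => MeasBdd.mul ⟨?_, 1, fun a => ?_⟩ (hf i)
  · exact Measurable.ite (hk (MeasurableSet.singleton i)) measurable_const measurable_const
  · dsimp only
    split_ifs <;> simp

lemma measBdd_faureSum {b : ℕ} (hb : 0 < b) (S : ℕ → Equiv.Perm (Fin b)) (n : ℕ) :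
    MeasBdd fun z : ℕ × ℝ => faureSum S n z.1 z.2 := by
  refine MeasBdd.sum fun j _ => MeasBdd.select
    (f := fun i (z : ℕ × ℝ) => phi (S j) i ((b : ℝ) ^ j * z.2)) ?_
    (fun z => carryDigit_le hb j _ z.1) fun i => ?_
  · have h1 : Measurable fun z : ℕ × ℝ => (z.1, ⌊(b : ℝ) ^ j * z.2⌋₊) :=
      measurable_fst.prodMk (Nat.measurable_floor.comp (measurable_snd.const_mul _))
    exact (Measurable.of_discrete (f := fun p : ℕ × ℕ =>
      carryDigit b j (xIdx S j p.2) p.1)).comp h1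
  · exact (measBdd_phi hb (S j) i).comp (measurable_snd.const_mul _)

lemma measBdd_symFaureSum {b : ℕ} (hb : 0 < b) (S : ℕ → Equiv.Perm (Fin b)) (n : ℕ) :
    MeasBdd fun z : ℕ × ℝ => symFaureSum S n z.1 z.2 :=
  (measBdd_faureSum hb S n).add (measBdd_faureSum hb _ n)

lemma measBdd_symFaureSum_comp {α : Type*} [MeasurableSpace α] {b : ℕ} (hb : 0 < b)
    (S : ℕ → Equiv.Perm (Fin b)) (n : ℕ) {k : α → ℕ} {v : α → ℝ} (hk : Measurable k)
    (hv : Measurable v) : MeasBdd fun z => symFaureSum S n (k z) (v z) :=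
  (measBdd_symFaureSum hb S n).comp (u := fun z => (k z, v z)) (hk.prodMk hv)

lemma measurable_localDisc {ι : Type} [Fintype ι] (P : ι → ℝ × ℝ) :
    Measurable fun z : ℝ × ℝ => localDisc P z.1 z.2 := by
  simp only [localDisc, Finset.natCast_card_filter]
  refine Measurable.sub (Finset.measurable_sum _ fun i _ => ?_) (by fun_prop)
  refine Measurable.ite ?_ measurable_const measurable_const
  simp only [Set.ofPred_and]
  exact (MeasurableSet.const _).inter ((measurableSet_lt measurable_const measurable_fst).inter
    ((MeasurableSet.const _).inter (measurableSet_lt measurable_const measurable_snd)))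

lemma abs_integral_sq_sub_le {α : Type*} [MeasurableSpace α] {μ : MeasureTheory.Measure α}
    [MeasureTheory.IsProbabilityMeasure μ] {f g : α → ℝ} {C δ : ℝ} (hδ : 0 < δ)
    (hf : Measurable f) (hg : MeasBdd g) (hfg : ∀ᵐ z ∂μ, |f z - g z| ≤ C) :
    MeasureTheory.Integrable (fun z => f z ^ 2) μ ∧
    |∫ z, f z ^ 2 ∂μ - ∫ z, g z ^ 2 ∂μ| ≤ δ * ∫ z, g z ^ 2 ∂μ + (C ^ 2 + C ^ 2 / δ) := by
  have hgi := hg.sq.integrable μ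
  have hbound : ∀ᵐ z ∂μ, |f z ^ 2 - g z ^ 2| ≤ δ * g z ^ 2 + (C ^ 2 + C ^ 2 / δ) := by
    filter_upwards [hfg] with z hz
    have hC : 0 ≤ C := (abs_nonneg _).trans hz
    have h1 : f z ^ 2 - g z ^ 2 = (f z - g z) * ((f z - g z) + 2 * g z) := by ring
    have h2 : |f z - g z + 2 * g z| ≤ C + 2 * |g z| := by
      refine (abs_add_le _ _).trans ?_
      rw [abs_mul, abs_two]
      linarith
    have h3 : 2 * (C * |g z|) ≤ δ * g z ^ 2 + C ^ 2 / δ := by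
      have h4 : 0 ≤ (δ * |g z| - C) ^ 2 / δ := by positivity
      have h5 : (δ * |g z| - C) ^ 2 / δ = δ * g z ^ 2 + C ^ 2 / δ - 2 * (C * |g z|) := by
        rw [← sq_abs (g z)]
        field_simp
        ring
      linarith
    rw [h1, abs_mul]
    calc _ ≤ C * (C + 2 * |g z|) := mul_le_mul hz h2 (abs_nonneg _) hC
      _ ≤ _ := by nlinarith
  have hmaj : MeasureTheory.Integrable (fun z => δ * g z ^ 2 + (C ^ 2 + C ^ 2 / δ)) μ :=
    (hgi.const_mul δ).add (MeasureTheory.integrable_const _)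
  have hdiff : MeasureTheory.Integrable (fun z => f z ^ 2 - g z ^ 2) μ :=
    hmaj.mono' ((hf.pow_const 2).sub hg.sq.1).aestronglyMeasurable hbound
  have hfi : MeasureTheory.Integrable (fun z => f z ^ 2) μ :=
    (hdiff.add hgi).congr (Filter.Eventually.of_forall fun z => by simp)
  refine ⟨hfi, ?_⟩
  rw [← MeasureTheory.integral_sub hfi hgi]
  refine (MeasureTheory.norm_integral_le_of_norm_le hmaj
    (f := fun z => f z ^ 2 - g z ^ 2) hbound).trans (le_of_eq ?_)
  rw [MeasureTheory.integral_add (hgi.const_mul δ) (MeasureTheory.integrable_const _),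
    MeasureTheory.integral_const_mul]
  simp

lemma integral_symFaureSum_natFloor_sq {b : ℕ} (hb : 0 < b) (σ : Equiv.Perm (Fin b))
    (S : ℕ → Equiv.Perm (Fin b)) (hS : ∀ j, S j = σ ∨ S j = pbar σ) (n : ℕ) :
    ∫ x in (0:ℝ)..1, ∫ y in (0:ℝ)..1, symFaureSum S n ⌊(b : ℝ) ^ n * x⌋₊ y ^ 2
      = ∑ j ∈ range n, 2 * (PhiS2 σ + PhiT σ
          + carryProb (b ^ j) * (PhiT1 σ + PhiT2 σ - 2 * PhiT σ)) := by
  have hl : ∀ l, MeasBdd fun y => symFaureSum S n l y ^ 2 := fun l =>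
    (measBdd_symFaureSum_comp hb S n measurable_const measurable_id).sq
  have h1 := (integral_natFloor_comp (pow_pos hb n)
    (fun l _ => ∫ y in (0:ℝ)..1, symFaureSum S n l y ^ 2) (fun _ _ => rfl)
    (fun _ => MeasBdd.const _)).2
  simp only [Nat.cast_pow, intervalIntegral.integral_const, sub_zero, one_smul] at h1
  rw [← integral_mean_symFaureSum_sq hb σ S hS n, h1, intervalIntegral.integral_const_mul,
    intervalIntegral.integral_finsetSum fun l _ => (hl l).intervalIntegrable 0 1]

lemma abs_integral_localDisc_sq_sub_le {b : ℕ} (hb : 0 < b) (σ : Equiv.Perm (Fin b))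
    (S : ℕ → Equiv.Perm (Fin b)) (hS : ∀ j, S j = σ ∨ S j = pbar σ) (n : ℕ) {δ : ℝ} (hδ : 0 < δ) :
    |(∫ x in (0:ℝ)..1, ∫ y in (0:ℝ)..1, localDisc (symFam b n fun i => S i) x y ^ 2)
        - ∑ j ∈ range n, 2 * (PhiS2 σ + PhiT σ
          + carryProb (b ^ j) * (PhiT1 σ + PhiT2 σ - 2 * PhiT σ))|
      ≤ δ * (∑ j ∈ range n, 2 * (PhiS2 σ + PhiT σ
          + carryProb (b ^ j) * (PhiT1 σ + PhiT2 σ - 2 * PhiT σ))) + (8 ^ 2 + 8 ^ 2 / δ) := by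
  obtain ⟨μ, hμ⟩ : ∃ μ : MeasureTheory.Measure ℝ,
      μ = MeasureTheory.volume.restrict (Set.Ioo 0 1) := ⟨_, rfl⟩
  have : MeasureTheory.IsProbabilityMeasure μ := ⟨by simp [hμ]⟩
  have hI : ∀ f : ℝ → ℝ, ∫ x in (0:ℝ)..1, f x = ∫ x, f x ∂μ := fun f => by
    rw [intervalIntegral.integral_of_le zero_le_one, MeasureTheory.integral_Ioc_eq_integral_Ioo, hμ]
  have hg : MeasBdd fun z : ℝ × ℝ => symFaureSum S n ⌊(b : ℝ) ^ n * z.1⌋₊ z.2 :=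
    measBdd_symFaureSum_comp hb S n (measurable_fst.const_mul _).nat_floor measurable_snd
  have hae : ∀ᵐ z ∂μ.prod μ, |localDisc (symFam b n fun i => S i) z.1 z.2
      - symFaureSum S n ⌊(b : ℝ) ^ n * z.1⌋₊ z.2| ≤ 8 := by
    rw [hμ, MeasureTheory.Measure.prod_restrict]
    refine MeasureTheory.ae_restrict_of_forall_mem (measurableSet_Ioo.prod measurableSet_Ioo) ?_
    rintro ⟨x, y⟩ ⟨hx, hy⟩
    exact abs_localDisc_symFam_sub_le hb n S hx.1.le hx.2 hy.1.le hy.2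
  obtain ⟨hfi, hle⟩ := abs_integral_sq_sub_le hδ (measurable_localDisc _) hg hae
  have hsum : ∫ z, symFaureSum S n ⌊(b : ℝ) ^ n * z.1⌋₊ z.2 ^ 2 ∂μ.prod μ
      = ∑ j ∈ range n, 2 * (PhiS2 σ + PhiT σ
          + carryProb (b ^ j) * (PhiT1 σ + PhiT2 σ - 2 * PhiT σ)) := by
    rw [MeasureTheory.integral_prod _ (hg.sq.integrable _),
      ← integral_symFaureSum_natFloor_sq hb σ S hS n]
    simp only [hI]
  rw [hsum, MeasureTheory.integral_prod _ hfi] at hle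
  simpa only [hI] using hle

lemma tendsto_integral_localDisc_sq_div {b : ℕ} (hb : 2 ≤ b) (σ : Equiv.Perm (Fin b))
    (S : (n : ℕ) → Fin n → Equiv.Perm (Fin b))
    (hS : ∀ n, ∀ i : Fin n, S n i = σ ∨ S n i = pbar σ) :
    Filter.Tendsto (fun n : ℕ =>
        (∫ x in (0:ℝ)..1, ∫ y in (0:ℝ)..1, localDisc (symFam b n (S n)) x y ^ 2) / (n : ℝ))
      Filter.atTop
      (nhds (2 * PhiS2 σ + PhiT σ + (1 / 2) * PhiT1 σ + (1 / 2) * PhiT2 σ)) := by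
  let J : ℕ → ℝ := fun n => ∑ j ∈ range n, 2 * (PhiS2 σ + PhiT σ
        + carryProb (b ^ j) * (PhiT1 σ + PhiT2 σ - 2 * PhiT σ))
  have hJ : Filter.Tendsto (fun n : ℕ => J n / (n : ℝ)) Filter.atTop
      (nhds (2 * PhiS2 σ + PhiT σ + (1 / 2) * PhiT1 σ + (1 / 2) * PhiT2 σ)) :=
    tendsto_mean_carryProb hb σ
  have hsqrt : Filter.Tendsto (fun n : ℕ => 1 / Real.sqrt n) Filter.atTop (nhds 0) := by
    simp only [one_div]
    exact (Real.tendsto_sqrt_atTop.comp tendsto_natCast_atTop_atTop).inv_tendsto_atTop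
  have herr : Filter.Tendsto (fun n : ℕ => 1 / Real.sqrt n * (J n / n)
      + (64 * (1 / (n : ℝ)) + 64 * (1 / Real.sqrt n))) Filter.atTop (nhds 0) := by
    have := (hsqrt.mul hJ).add (((tendsto_one_div_atTop_nhds_zero_nat (𝕜 := ℝ)).const_mul 64).add
      (hsqrt.const_mul 64))
    simpa using this
  have hdiff : Filter.Tendsto (fun n : ℕ =>
        (∫ x in (0:ℝ)..1, ∫ y in (0:ℝ)..1, localDisc (symFam b n (S n)) x y ^ 2) / (n : ℝ)
        - J n / n) Filter.atTop (nhds 0) := by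
    refine squeeze_zero_norm' ?_ herr
    filter_upwards [Filter.eventually_gt_atTop 0] with n hn
    have hn' : (0 : ℝ) < n := by exact_mod_cast hn
    have hs : 0 < Real.sqrt n := Real.sqrt_pos.2 hn'
    let S' : ℕ → Equiv.Perm (Fin b) := fun i => if h : i < n then S n ⟨i, h⟩ else σ
    have hS' : ∀ j, S' j = σ ∨ S' j = pbar σ := by
      intro j
      by_cases h : j < n
      · simpa [S', h] using hS n ⟨j, h⟩
      · simp [S', h]
    have heq : (fun i : Fin n => S' i) = S n := by
      funext i
      simp [S']
    have hle := abs_integral_localDisc_sq_sub_le (by omega) σ S' hS' n (one_div_pos.2 hs)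
    rw [heq] at hle
    rw [← sub_div, Real.norm_eq_abs, abs_div, abs_of_pos hn', div_le_iff₀ hn']
    refine hle.trans (le_of_eq ?_)
    have hss : (n : ℝ) = Real.sqrt n * Real.sqrt n := (Real.mul_self_sqrt hn'.le).symm
    change 1 / Real.sqrt n * J n + (8 ^ 2 + 8 ^ 2 / (1 / Real.sqrt n)) = _
    generalize J n = t
    generalize Real.sqrt (n : ℝ) = s at hs hss
    rw [hss]
    field_simp
    ring
  simpa only [zero_add, sub_add_cancel] using hdiff.add hJ

theorem stmt12 (b : ℕ) (hb : 2 ≤ b) (σ : Equiv.Perm (Fin b))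
    (hcomm : (tauP b).trans σ = σ.trans (tauP b))
    (S : (n : ℕ) → Fin n → Equiv.Perm (Fin b))
    (hS : ∀ n, ∀ i : Fin n, S n i = σ ∨ S n i = pbar σ) :
    Filter.Tendsto
      (fun n : ℕ =>
        (2 * (b : ℝ) ^ n * L2disc (symFam b n (S n)))
          / Real.sqrt (Real.log (2 * (b : ℝ) ^ n)))
      Filter.atTop
      (nhds (Real.sqrt
        ((2 * PhiS2 σ + PhiT σ + (1 / 2) * PhiT1 σ + (1 / 2) * PhiT2 σ)
          / Real.log b))) := by
  have hlogb : 0 < Real.log b := Real.log_pos (by exact_mod_cast hb)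
  have hb0 : (0 : ℝ) < b := by positivity
  have hI := tendsto_integral_localDisc_sq_div hb σ S hS
  have hlog : Filter.Tendsto (fun n : ℕ => Real.log 2 * (1 / (n : ℝ)) + Real.log b) Filter.atTop
      (nhds (Real.log b)) := by
    simpa using ((tendsto_one_div_atTop_nhds_zero_nat (𝕜 := ℝ)).const_mul (Real.log 2)).add_const
      (Real.log b)
  refine ((Real.continuous_sqrt.tendsto _).comp (hI.div hlog hlogb.ne')).congr' ?_
  filter_upwards [Filter.eventually_gt_atTop 0] with n hn
  have hn' : (0 : ℝ) < n := by exact_mod_cast hn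
  have hbn : (0 : ℝ) < (b : ℝ) ^ n := by positivity
  have hlog_eq : Real.log (2 * (b : ℝ) ^ n) = Real.log 2 + n * Real.log b := by
    rw [Real.log_mul two_ne_zero hbn.ne', Real.log_pow]
  have hlog_pos : 0 < Real.log (2 * (b : ℝ) ^ n) := by
    rw [hlog_eq]
    have := Real.log_pos one_lt_two
    positivity
  have hcard : (Fintype.card (Bool × (Fin n → Fin b)) : ℝ) = 2 * (b : ℝ) ^ n := by simp
  rw [L2disc, hcard, ← mul_assoc, mul_one_div_cancel (by positivity), one_mul,
    ← Real.sqrt_div' _ hlog_pos.le, hlog_eq]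
  simp only [Function.comp_apply, Pi.div_apply]
  congr 1
  rw [div_div]
  congr 1
  field_simp

end SymHamm
end
end

section
/- Let b ≥ 2, let σ be a permutation of {0,…,b−1} with σ∘τ = τ∘σ (where τ(k) = b−1−k), and let d ∈ {0,…,b−1}. Define the permutation σ̂ by σ̂(k) = σ(k) for k ∈ {0,…,b−1}∖{d, b−1−d}, σ̂(d) = σ(b−1−d), and σ̂(b−1−d) = σ(d). Then σ̂ also satisfies σ̂∘τ = τ∘σ̂ and c_b^σ = c_b^{σ̂}, where c_b^σ = (16 − 12b − 111b^2 + 228b^3 − 112b^4)/(72b^2) − (1 − (−1)^b)/(16b^3) + (4/b^3)·∑_{k_1=0}^{b−1} ∑_{k_2=0}^{b−1} max(σ(k_1),σ(k_2))·((b/2)·(max(k_1,k_2) + max(k_1+k_2, b−1)) − k_1^2 − k_1), and analogously for σ̂. -/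
open Finset
open scoped Classical

noncomputable section

namespace SymHamm

/-- The closed-form expression for the constant `c_b^σ` from Lemma `altern`. -/
def cClosed (b : ℕ) (σ : Equiv.Perm (Fin b)) : ℝ :=
  (16 - 12 * (b : ℝ) - 111 * (b : ℝ) ^ 2 + 228 * (b : ℝ) ^ 3 - 112 * (b : ℝ) ^ 4)
      / (72 * (b : ℝ) ^ 2)
    - (1 - (-1 : ℝ) ^ b) / (16 * (b : ℝ) ^ 3)
    + (4 / (b : ℝ) ^ 3) *
        ∑ k1 : Fin b, ∑ k2 : Fin b,
          ((max ((σ k1 : ℕ)) ((σ k2 : ℕ)) : ℕ) : ℝ) *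
            ((b : ℝ) / 2 *
                (((max ((k1 : ℕ)) ((k2 : ℕ)) : ℕ) : ℝ)
                  + ((max ((k1 : ℕ) + (k2 : ℕ)) (b - 1) : ℕ) : ℝ))
              - ((k1 : ℕ) : ℝ) ^ 2 - ((k1 : ℕ) : ℝ))

/-- The part of the weight in `cClosed` that is invariant under reversal of either argument:
it differs from the full weight by the antisymmetric term `(b / 2) * (k₂ - k₁)`. -/
def evenWeight (b : ℕ) (k₁ k₂ : Fin b) : ℝ :=
  (b : ℝ) / 2 * (max (k₁ : ℝ) k₂ + max ((k₁ : ℝ) + k₂) ((b : ℝ) - 1) - k₂ + k₁)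
    - (k₁ : ℝ) ^ 2 - k₁

lemma coe_rev_real {b : ℕ} (k : Fin b) : ((k.rev : ℕ) : ℝ) = (b : ℝ) - 1 - k := by
  have h := k.isLt
  rw [Fin.val_rev, Nat.cast_sub (by omega)]
  push_cast
  ring

lemma evenWeight_rev_right {b : ℕ} (k₁ k₂ : Fin b) :
    evenWeight b k₁ k₂.rev = evenWeight b k₁ k₂ := by
  simp only [evenWeight, coe_rev_real]
  congr 3
  grind

lemma evenWeight_rev_left {b : ℕ} (k₁ k₂ : Fin b) :
    evenWeight b k₁.rev k₂ = evenWeight b k₁ k₂ := by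
  simp only [evenWeight, coe_rev_real]
  have h : max ((b : ℝ) - 1 - k₁) k₂ + max ((b : ℝ) - 1 - k₁ + k₂) ((b : ℝ) - 1)
      = max (k₁ : ℝ) k₂ + max ((k₁ : ℝ) + k₂) ((b : ℝ) - 1) + (b - 1) - 2 * k₁ := by
    grind
  rw [h]
  ring

lemma evenWeight_map {b : ℕ} (s : Equiv.Perm (Fin b)) (hs : ∀ k, s k = k ∨ s k = k.rev)
    (k₁ k₂ : Fin b) : evenWeight b (s k₁) (s k₂) = evenWeight b k₁ k₂ := by
  rcases hs k₁ with h₁ | h₁ <;> rcases hs k₂ with h₂ | h₂ <;>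
    simp only [h₁, h₂, evenWeight_rev_left, evenWeight_rev_right]

lemma sum_mul_sub_eq_zero {ι : Type*} [Fintype ι] (M : ι → ι → ℝ) (hM : ∀ i j, M i j = M j i)
    (c : ℝ) (f : ι → ℝ) : ∑ i, ∑ j, M i j * (c * (f j - f i)) = 0 := by
  have h : ∑ i, ∑ j, M i j * (c * (f j - f i)) = -∑ i, ∑ j, M i j * (c * (f j - f i)) := by
    conv_lhs => rw [Finset.sum_comm]
    simp only [← Finset.sum_neg_distrib]
    refine Finset.sum_congr rfl fun i _ => Finset.sum_congr rfl fun j _ => ?_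
    rw [hM j i]
    ring
  linarith

lemma cClosed_eq_evenWeight {b : ℕ} (σ : Equiv.Perm (Fin b)) :
    cClosed b σ =
      (16 - 12 * (b : ℝ) - 111 * (b : ℝ) ^ 2 + 228 * (b : ℝ) ^ 3 - 112 * (b : ℝ) ^ 4)
          / (72 * (b : ℝ) ^ 2)
        - (1 - (-1 : ℝ) ^ b) / (16 * (b : ℝ) ^ 3)
        + (4 / (b : ℝ) ^ 3) *
            ∑ k₁ : Fin b, ∑ k₂ : Fin b,
              ((max (σ k₁ : ℕ) (σ k₂ : ℕ) : ℕ) : ℝ) * evenWeight b k₁ k₂ := by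
  have h := sum_mul_sub_eq_zero (fun k₁ k₂ : Fin b => ((max (σ k₁ : ℕ) (σ k₂ : ℕ) : ℕ) : ℝ))
    (fun i j => by rw [max_comm]) ((b : ℝ) / 2) (fun k => ((k : ℕ) : ℝ))
  unfold cClosed
  congr 2
  rw [← sub_eq_zero, ← h]
  simp only [← Finset.sum_sub_distrib]
  refine Finset.sum_congr rfl fun k₁ _ => Finset.sum_congr rfl fun k₂ _ => ?_
  have hb : 1 ≤ b := k₁.pos
  simp only [evenWeight, Nat.cast_max, Nat.cast_add, Nat.cast_sub hb, Nat.cast_one]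
  ring

/-- Precomposing with a permutation that fixes or reverses every digit preserves `cClosed`. -/
lemma cClosed_mul_eq {b : ℕ} (σ s : Equiv.Perm (Fin b)) (hs : ∀ k, s k = k ∨ s k = k.rev) :
    cClosed b (σ * s) = cClosed b σ := by
  rw [cClosed_eq_evenWeight, cClosed_eq_evenWeight]
  congr 2
  symm
  rw [← Equiv.sum_comp s]
  refine Finset.sum_congr rfl fun k₁ _ => ?_
  rw [← Equiv.sum_comp s]
  refine Finset.sum_congr rfl fun k₂ _ => ?_
  rw [evenWeight_map s hs, Equiv.Perm.mul_apply, Equiv.Perm.mul_apply]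

lemma swap_rev_apply {b : ℕ} (x k : Fin b) :
    Equiv.swap x x.rev k = k ∨ Equiv.swap x x.rev k = k.rev := by
  rw [Equiv.swap_apply_def]
  split_ifs with h₁ h₂
  · exact Or.inr (by rw [h₁])
  · exact Or.inr (by rw [h₂, Fin.rev_rev])
  · exact Or.inl rfl

lemma swap_rev_comm {b : ℕ} (x k : Fin b) :
    Equiv.swap x x.rev k.rev = (Equiv.swap x x.rev k).rev := by
  have h := Fin.revPerm.injective.swap_apply x x.rev k
  simp only [Fin.revPerm_apply, Fin.rev_rev] at h
  rw [← h, Equiv.swap_comm]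

theorem stmt14 (b : ℕ) (hb : 2 ≤ b) (σ : Equiv.Perm (Fin b))
    (hcomm : (tauP b).trans σ = σ.trans (tauP b))
    (d : ℕ) (hd : d < b) :
    ((tauP b).trans (σ * Equiv.swap (⟨d, hd⟩ : Fin b) (⟨b - 1 - d, by omega⟩ : Fin b)) =
        (σ * Equiv.swap (⟨d, hd⟩ : Fin b) (⟨b - 1 - d, by omega⟩ : Fin b)).trans (tauP b))
      ∧ cClosed b σ =
          cClosed b (σ * Equiv.swap (⟨d, hd⟩ : Fin b) (⟨b - 1 - d, by omega⟩ : Fin b)) := by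
  have hx : (⟨b - 1 - d, by omega⟩ : Fin b) = (⟨d, hd⟩ : Fin b).rev := by
    ext
    simp only [Fin.val_rev]
    omega
  rw [hx]
  refine ⟨?_, (cClosed_mul_eq σ _ (swap_rev_apply _)).symm⟩
  ext1 k
  have h := DFunLike.congr_fun hcomm (Equiv.swap (⟨d, hd⟩ : Fin b) (⟨d, hd⟩ : Fin b).rev k)
  simp only [tauP, Equiv.trans_apply, Equiv.Perm.mul_apply, Fin.revPerm_apply] at h ⊢
  rw [swap_rev_comm, h]

end SymHamm
end
end
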